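/- Let X be the self-repelling random walk with directed edges and weight function w. Fix x ∈ ℝ and h > 0. Then, as A → ∞, A⁻¹·λ±_{⌊Ax⌋,⌊Ah⌋} → −|x|−2h in probability and A⁻¹·ρ±_{⌊Ax⌋,⌊Ah⌋} → |x|+2h in probability, where λ±_{j,r} and ρ±_{j,r} are respectively the leftmost and rightmost edges visited by the walk before the inverse local time T±_{j,r}. -/

import Mathlib

open MeasureTheory Filter
open scoped BigOperators ENNReal Topology

noncomputable section

/-- The weight function `w` is positive, nondecreasing and satisfies
`lim_{z→∞} (w(z) - w(-z)) > 0`. -/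
def GoodWeight (w : ℤ → ℝ) : Prop :=
  (∀ z, 0 < w z) ∧ (∀ z, w z ≤ w (z + 1)) ∧
    ∃ c > (0 : ℝ), ∀ᶠ z : ℤ in atTop, c ≤ w z - w (-z)

/-- Local time of the path `x` on the oriented edge from `k` to `k+1` up to time `n`. -/
def dirLocP (x : ℕ → ℤ) (n : ℕ) (k : ℤ) : ℕ :=
  ((Finset.range n).filter fun j => x j = k ∧ x (j + 1) = k + 1).card

/-- Local time of the path `x` on the oriented edge from `k` to `k-1` up to time `n`. -/
def dirLocM (x : ℕ → ℤ) (n : ℕ) (k : ℤ) : ℕ :=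
  ((Finset.range n).filter fun j => x j = k ∧ x (j + 1) = k - 1).card

/-- The conditional probability, given the past path `x` up to time `n`, that the
self-repelling walk with weight `w` makes the step `x n → x (n+1)`. -/
def stepProb (w : ℤ → ℝ) (x : ℕ → ℤ) (n : ℕ) : ℝ :=
  let Δ : ℤ := (dirLocP x n (x n) : ℤ) - (dirLocM x n (x n) : ℤ)
  if x (n + 1) = x n + 1 then w (-Δ) / (w Δ + w (-Δ))
  else if x (n + 1) = x n - 1 then w Δ / (w Δ + w (-Δ))
  else 0

/-- `X` is the self-repelling random walk with directed edges and weight function `w`: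
it starts at `0` and its cylinder probabilities evolve by the self-repelling
transition probabilities. -/
def IsSRW {Ω : Type*} [MeasurableSpace Ω] (μ : Measure Ω) (w : ℤ → ℝ)
    (X : ℕ → Ω → ℤ) : Prop :=
  (∀ n, Measurable (X n)) ∧
  μ {ω | X 0 ω = 0} = 1 ∧
  ∀ (n : ℕ) (x : ℕ → ℤ),
    μ {ω | ∀ i ≤ n + 1, X i ω = x i} =
      μ {ω | ∀ i ≤ n, X i ω = x i} * ENNReal.ofReal (stepProb w x n)

/-- Inverse local time `T⁺_{j,r} = min{n ≥ 0 : ℓ⁺(n,j) ≥ r}` of the path `x`. -/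
def Tp (x : ℕ → ℤ) (j : ℤ) (r : ℕ) : ℕ := sInf {n | r ≤ dirLocP x n j}

/-- Inverse local time `T⁻_{j,r} = min{n ≥ 0 : ℓ⁻(n,j) ≥ r}` of the path `x`. -/
def Tm (x : ℕ → ℤ) (j : ℤ) (r : ℕ) : ℕ := sInf {n | r ≤ dirLocM x n j}

/-- `Λ⁺_{j,r}(k) = ℓ⁺(T⁺_{j,r},k) + ℓ⁻(T⁺_{j,r},k+1)`. -/
def LamP (x : ℕ → ℤ) (j : ℤ) (r : ℕ) (k : ℤ) : ℕ :=
  dirLocP x (Tp x j r) k + dirLocM x (Tp x j r) (k + 1)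

/-- `Λ⁻_{j,r}(k) = ℓ⁺(T⁻_{j,r},k) + ℓ⁻(T⁻_{j,r},k+1)`. -/
def LamM (x : ℕ → ℤ) (j : ℤ) (r : ℕ) (k : ℤ) : ℕ :=
  dirLocP x (Tm x j r) k + dirLocM x (Tm x j r) (k + 1)

/-- Leftmost edge `λ⁺_{j,r}` visited before `T⁺_{j,r}`. -/
def lamEdgeP (x : ℕ → ℤ) (j : ℤ) (r : ℕ) : ℤ := sInf {k : ℤ | 0 < LamP x j r k}

/-- Leftmost edge `λ⁻_{j,r}` visited before `T⁻_{j,r}`. -/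
def lamEdgeM (x : ℕ → ℤ) (j : ℤ) (r : ℕ) : ℤ := sInf {k : ℤ | 0 < LamM x j r k}

/-- Rightmost edge `ρ⁺_{j,r}` visited before `T⁺_{j,r}`. -/
def rhoEdgeP (x : ℕ → ℤ) (j : ℤ) (r : ℕ) : ℤ := sSup {k : ℤ | 0 < LamP x j r k}

/-- Rightmost edge `ρ⁻_{j,r}` visited before `T⁻_{j,r}`. -/
def rhoEdgeM (x : ℕ → ℤ) (j : ℤ) (r : ℕ) : ℤ := sSup {k : ℤ | 0 < LamM x j r k}

/-! ### Local transition probabilities and the stationary flux -/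

/-- Probability of an upward step when the local discrepancy is `z`. -/
def upProb (w : ℤ → ℝ) (z : ℤ) : ℝ := w (-z) / (w z + w (-z))

/-- Probability of a downward step when the local discrepancy is `z`. -/
def downProb (w : ℤ → ℝ) (z : ℤ) : ℝ := w z / (w z + w (-z))

/-- Stationary flux of the discrepancy chain, on nonnegative edges. -/
def fluxNat (w : ℤ → ℝ) : ℕ → ℝ
  | 0 => 1
  | n + 1 => fluxNat w n * (w (-((n : ℤ) + 1)) / w ((n : ℤ) + 1))

/-- Stationary flux of the discrepancy chain through the edge between `z` and `z + 1`. -/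
def flux (w : ℤ → ℝ) : ℤ → ℝ
  | Int.ofNat n => fluxNat w n
  | Int.negSucc n => fluxNat w n

/-- Reversible measure of the discrepancy chain. -/
def stat (w : ℤ → ℝ) (z : ℤ) : ℝ := flux w z + flux w (z - 1)

/-- Probability that the discrepancy chain started from `0` makes `u` upward and `v` downward
steps among its first `u + v` steps. -/
def passProb (w : ℤ → ℝ) : ℕ → ℕ → ℝ
  | 0, 0 => 1
  | u + 1, 0 => passProb w u 0 * upProb w u
  | 0, v + 1 => passProb w 0 v * downProb w (-v)
  | u + 1, v + 1 => passProb w u (v + 1) * upProb w ((u : ℤ) - (v + 1)) +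
      passProb w (u + 1) v * downProb w ((u : ℤ) + 1 - v)

/-- Law of the number of upward steps before the `d`-th downward step. -/
def roundKernel (w : ℤ → ℝ) : ℕ → ℕ → ℝ
  | 0, e => if e = 0 then 1 else 0
  | d + 1, e => passProb w e d * downProb w ((e : ℤ) - d)

/-- `passProb` in terms of the number of downward steps and of the discrepancy. -/
def shiftPass (w : ℤ → ℝ) (d : ℕ) (x : ℤ) : ℝ :=
  if 0 ≤ x + d then passProb w (x + d).toNat d else 0

section Weights

variable {w : ℤ → ℝ}

lemma upProb_neg (z : ℤ) : upProb w (-z) = downProb w z := by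
  simp [upProb, downProb, add_comm]

lemma downProb_neg (z : ℤ) : downProb w (-z) = upProb w z := by
  simp [upProb, downProb, add_comm]

lemma upProb_pos (hp : ∀ z, 0 < w z) (z : ℤ) : 0 < upProb w z :=
  div_pos (hp _) (add_pos (hp _) (hp _))

lemma downProb_pos (hp : ∀ z, 0 < w z) (z : ℤ) : 0 < downProb w z :=
  div_pos (hp _) (add_pos (hp _) (hp _))

lemma upProb_add_downProb (hp : ∀ z, 0 < w z) (z : ℤ) : upProb w z + downProb w z = 1 := by
  have := (add_pos (hp z) (hp (-z))).ne'
  unfold upProb downProb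
  field_simp
  ring

lemma fluxNat_pos (hp : ∀ z, 0 < w z) (n : ℕ) : 0 < fluxNat w n := by
  induction n with
  | zero => simp [fluxNat]
  | succ n ih => exact mul_pos ih (div_pos (hp _) (hp _))

lemma flux_pos (hp : ∀ z, 0 < w z) (x : ℤ) : 0 < flux w x := by
  cases x <;> exact fluxNat_pos hp _

lemma stat_pos (hp : ∀ z, 0 < w z) (x : ℤ) : 0 < stat w x :=
  add_pos (flux_pos hp _) (flux_pos hp _)

lemma flux_reflect (x : ℤ) : flux w (-1 - x) = flux w x := by
  cases x with
  | ofNat n =>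
    have : (-1 - Int.ofNat n : ℤ) = Int.negSucc n := by
      rw [Int.negSucc_eq]; simp; ring
    rw [this]; rfl
  | negSucc n =>
    have : (-1 - Int.negSucc n : ℤ) = Int.ofNat n := by
      rw [Int.negSucc_eq]; simp
    rw [this]; rfl

lemma flux_mul_weight (hp : ∀ z, 0 < w z) (x : ℤ) :
    flux w x * w x = flux w (x - 1) * w (-x) := by
  have key (n : ℕ) : fluxNat w (n + 1) * w ((n : ℤ) + 1) = fluxNat w n * w (-((n : ℤ) + 1)) := by
    have := (hp ((n : ℤ) + 1)).ne'
    simp only [fluxNat]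
    field_simp
  rcases x with n | n
  · rcases n with _ | n
    · have : (Int.ofNat 0 - 1 : ℤ) = Int.negSucc 0 := rfl
      rw [this]
      simp [flux]
    · have : (Int.ofNat (n + 1) - 1 : ℤ) = Int.ofNat n := by simp
      rw [this]
      have := key n
      simpa [flux] using this
  · have : (Int.negSucc n - 1 : ℤ) = Int.negSucc (n + 1) := by
      rw [Int.negSucc_eq, Int.negSucc_eq]; push_cast; ring
    rw [this]
    have := key n
    simp only [flux, Int.negSucc_eq, neg_neg]
    linarith

lemma flux_mul_downProb (hp : ∀ z, 0 < w z) (x : ℤ) :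
    flux w x * downProb w x = flux w (x - 1) * upProb w x := by
  have := flux_mul_weight hp x
  unfold upProb downProb
  rw [← mul_div_assoc, this, mul_div_assoc]

lemma stat_mul_upProb (hp : ∀ z, 0 < w z) (x : ℤ) : stat w x * upProb w x = flux w x := by
  have h1 := flux_mul_downProb hp x
  have h2 := upProb_add_downProb hp x
  unfold stat
  linear_combination (flux w x) * h2 - h1

lemma stat_mul_downProb (hp : ∀ z, 0 < w z) (x : ℤ) :
    stat w x * downProb w x = flux w (x - 1) := by
  have h1 := flux_mul_downProb hp x
  have h2 := upProb_add_downProb hp x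
  unfold stat
  linear_combination (flux w (x - 1)) * h2 + h1

lemma passProb_pos (hp : ∀ z, 0 < w z) (u v : ℕ) : 0 < passProb w u v := by
  induction v generalizing u with
  | zero =>
    induction u with
    | zero => simp [passProb]
    | succ u ih => simpa only [passProb] using mul_pos ih (upProb_pos hp _)
  | succ v ihv =>
    induction u with
    | zero => simpa only [passProb] using mul_pos (ihv 0) (downProb_pos hp _)
    | succ u ih =>
      simpa only [passProb] using
        add_pos (mul_pos ih (upProb_pos hp _)) (mul_pos (ihv _) (downProb_pos hp _))

lemma passProb_comm (u v : ℕ) : passProb w u v = passProb w v u := by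
  induction u generalizing v with
  | zero =>
    induction v with
    | zero => rfl
    | succ v ih => simp only [passProb]; rw [ih, downProb_neg]
  | succ u ihu =>
    induction v with
    | zero => simp only [passProb]; rw [ihu, downProb_neg]
    | succ v ih =>
      simp only [passProb]
      have h1 : upProb w ((u : ℤ) - (v + 1)) = downProb w ((v : ℤ) + 1 - u) := by
        rw [← upProb_neg]; congr 1; ring
      have h2 : upProb w ((v : ℤ) - (u + 1)) = downProb w ((u : ℤ) + 1 - v) := by
        rw [← upProb_neg]; congr 1; ring
      rw [ih, ihu, h1, h2]
      ring

lemma roundKernel_nonneg (hp : ∀ z, 0 < w z) (d e : ℕ) : 0 ≤ roundKernel w d e := by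
  cases d with
  | zero => simp only [roundKernel]; split_ifs <;> norm_num
  | succ d => exact (mul_pos (passProb_pos hp _ _) (downProb_pos hp _)).le

lemma roundKernel_zero_right_pos (hp : ∀ z, 0 < w z) (d : ℕ) : 0 < roundKernel w d 0 := by
  cases d with
  | zero => simp [roundKernel]
  | succ d => exact mul_pos (passProb_pos hp _ _) (downProb_pos hp _)

lemma shiftPass_nonneg (hp : ∀ z, 0 < w z) (d : ℕ) (x : ℤ) : 0 ≤ shiftPass w d x := by
  unfold shiftPass
  split_ifs
  · exact (passProb_pos hp _ _).le
  · exact le_rfl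

lemma shiftPass_of_lt {d : ℕ} {x : ℤ} (h : x + d < 0) : shiftPass w d x = 0 :=
  if_neg (not_le.mpr h)

lemma shiftPass_natCast_sub (d e : ℕ) : shiftPass w d ((e : ℤ) - d) = passProb w e d := by
  simp [shiftPass]

lemma shiftPass_zero (x : ℤ) :
    shiftPass w 0 x = shiftPass w 0 (x - 1) * upProb w (x - 1) + if x = 0 then 1 else 0 := by
  rcases lt_trichotomy x 0 with h | rfl | h
  · rw [shiftPass_of_lt (by simpa using h), shiftPass_of_lt (by push_cast; omega), if_neg h.ne]
    simp
  · rw [shiftPass_of_lt (x := 0 - 1) (by norm_num)]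
    simp [shiftPass, passProb]
  · obtain ⟨n, rfl⟩ : ∃ n : ℕ, x = ((n + 1 : ℕ) : ℤ) - (0 : ℕ) := ⟨(x - 1).toNat, by simp; omega⟩
    rw [shiftPass_natCast_sub, if_neg (by push_cast; omega),
      show (((n + 1 : ℕ) : ℤ) - (0 : ℕ) - 1) = (n : ℤ) - (0 : ℕ) by push_cast; ring,
      shiftPass_natCast_sub]
    simp [passProb]

lemma shiftPass_succ (d : ℕ) (x : ℤ) :
    shiftPass w (d + 1) x = shiftPass w (d + 1) (x - 1) * upProb w (x - 1) +
      shiftPass w d (x + 1) * downProb w (x + 1) := by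
  rcases lt_trichotomy (x + (d + 1)) 0 with h | h | h
  · rw [shiftPass_of_lt (by push_cast; omega), shiftPass_of_lt (by push_cast; omega),
      shiftPass_of_lt (by omega)]
    simp
  · obtain rfl : x = ((0 : ℕ) : ℤ) - (d + 1 : ℕ) := by push_cast; omega
    rw [shiftPass_natCast_sub, shiftPass_of_lt (x := _ - 1) (by push_cast; omega),
      show (((0 : ℕ) : ℤ) - (d + 1 : ℕ) + 1) = ((0 : ℕ) : ℤ) - (d : ℕ) by push_cast; ring,
      shiftPass_natCast_sub]
    simp [passProb]
  · obtain ⟨n, rfl⟩ : ∃ n : ℕ, x = ((n + 1 : ℕ) : ℤ) - (d + 1 : ℕ) :=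
      ⟨(x + d).toNat, by push_cast; omega⟩
    rw [shiftPass_natCast_sub,
      show (((n + 1 : ℕ) : ℤ) - (d + 1 : ℕ) - 1) = (n : ℤ) - (d + 1 : ℕ) by push_cast; ring,
      show (((n + 1 : ℕ) : ℤ) - (d + 1 : ℕ) + 1) = ((n + 1 : ℕ) : ℤ) - d by push_cast; ring,
      shiftPass_natCast_sub, shiftPass_natCast_sub]
    simp only [passProb]
    push_cast
    rfl

lemma passProb_le_stat (hp : ∀ z, 0 < w z) (u v : ℕ) :
    passProb w u v ≤ stat w ((u : ℤ) - v) := by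
  have hup (x : ℤ) : stat w x * upProb w x ≤ stat w (x + 1) := by
    rw [stat_mul_upProb hp]; unfold stat
    have := flux_pos hp (x + 1)
    rw [add_sub_cancel_right]; linarith
  have hdown (x : ℤ) : stat w x * downProb w x ≤ stat w (x - 1) := by
    rw [stat_mul_downProb hp]; unfold stat
    have := flux_pos hp (x - 1 - 1)
    linarith
  induction v generalizing u with
  | zero =>
    induction u with
    | zero =>
      have : (0 : ℤ) - 1 = Int.negSucc 0 := rfl
      have h0 : flux w 0 = 1 := rfl
      simp [passProb, stat, h0, (flux_pos hp _).le]
    | succ u ih =>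
      simp only [passProb]
      calc _ ≤ stat w ((u : ℤ) - (0 : ℕ)) * upProb w u :=
            mul_le_mul_of_nonneg_right ih (upProb_pos hp _).le
        _ ≤ _ := by simpa using hup u
  | succ v ihv =>
    induction u with
    | zero =>
      simp only [passProb]
      calc _ ≤ stat w (((0 : ℕ) : ℤ) - v) * downProb w (-v) :=
            mul_le_mul_of_nonneg_right (ihv 0) (downProb_pos hp _).le
        _ ≤ _ := by
            have := hdown (-v)
            simp only [Nat.cast_zero, zero_sub, Nat.cast_add, Nat.cast_one]
            rwa [neg_add']
    | succ u ih =>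
      simp only [passProb]
      have h1 := mul_le_mul_of_nonneg_right ih (upProb_pos hp ((u : ℤ) - (v + 1))).le
      have h2 := mul_le_mul_of_nonneg_right (ihv (u + 1)) (downProb_pos hp ((u : ℤ) + 1 - v)).le
      push_cast at h1 h2 ⊢
      rw [stat_mul_upProb hp] at h1
      rw [stat_mul_downProb hp] at h2
      have e1 : (u : ℤ) + 1 - (v + 1) = (u : ℤ) - (v + 1) + 1 := by ring
      have e2 : (u : ℤ) + 1 - v - 1 = (u : ℤ) - (v + 1) + 1 := by ring
      rw [e2] at h2
      rw [e1]
      unfold stat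
      rw [add_sub_cancel_right]
      linarith

lemma shiftPass_le_stat (hp : ∀ z, 0 < w z) (d : ℕ) (x : ℤ) : shiftPass w d x ≤ stat w x := by
  unfold shiftPass
  split_ifs with h
  · have := passProb_le_stat hp (x + d).toNat d
    rwa [Int.toNat_of_nonneg h, add_sub_cancel_right] at this
  · exact (stat_pos hp x).le

end Weights

/-! ### Convergence of the embedded discrepancy chain -/

lemma HasSum.of_fun_eq {ι : Type*} {f g : ι → ℝ} {a : ℝ} (hf : HasSum f a)
    (h : ∀ x, g x = f x) : HasSum g a := by
  rwa [funext h]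

lemma HasSum.comp_add_one {f : ℤ → ℝ} {a : ℝ} (hf : HasSum f a) :
    HasSum (fun x => f (x + 1)) a :=
  (Equiv.addRight (1 : ℤ)).hasSum_iff.2 hf

lemma HasSum.comp_sub_one {f : ℤ → ℝ} {a : ℝ} (hf : HasSum f a) :
    HasSum (fun x => f (x - 1)) a :=
  (Equiv.subRight (1 : ℤ)).hasSum_iff.2 hf

lemma exists_weight_ratio_lt {w : ℤ → ℝ} (hw : GoodWeight w) :
    ∃ κ : ℝ, 0 < κ ∧ κ < 1 ∧ ∀ᶠ n : ℕ in atTop, w (-((n : ℤ) + 1)) / w ((n : ℤ) + 1) ≤ κ := by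
  obtain ⟨hp, hm, c, hc, hev⟩ := hw
  have hmono : Monotone w := monotone_int_of_le_succ hm
  have h0 := hp 0
  refine ⟨w 0 / (w 0 + c), by positivity, (div_lt_one (by positivity)).2 (by linarith), ?_⟩
  obtain ⟨z₀, hz₀⟩ := eventually_atTop.1 hev
  refine eventually_atTop.2 ⟨z₀.toNat, fun n hn => ?_⟩
  have h1 := hz₀ ((n : ℤ) + 1) (by omega)
  have h2 : w (-((n : ℤ) + 1)) ≤ w 0 := hmono (by omega)
  rw [div_le_div_iff₀ (hp _) (by positivity)]
  nlinarith [hp (-((n : ℤ) + 1))]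

lemma exists_summable_flux_exp {w : ℤ → ℝ} (hw : GoodWeight w) :
    ∃ θ : ℝ, 0 < θ ∧ Summable fun x : ℤ => flux w x * Real.exp (θ * |(x : ℝ)|) := by
  obtain ⟨κ, hκ0, hκ1, hev⟩ := exists_weight_ratio_lt hw
  have hp := hw.1
  have hlog : 1 < (1 + κ) / (2 * κ) := by
    rw [lt_div_iff₀ (by positivity)]; linarith
  refine ⟨Real.log ((1 + κ) / (2 * κ)), Real.log_pos hlog, ?_⟩
  set θ := Real.log ((1 + κ) / (2 * κ))
  have hθ : Real.exp θ = (1 + κ) / (2 * κ) := Real.exp_log (by linarith)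
  have hs : Summable fun n : ℕ => fluxNat w n * Real.exp (θ * n) := by
    refine summable_of_ratio_norm_eventually_le (r := (1 + κ) / 2) (by linarith) ?_
    filter_upwards [hev] with n hn
    have hpos (n : ℕ) : 0 < fluxNat w n * Real.exp (θ * n) :=
      mul_pos (fluxNat_pos hp n) (Real.exp_pos _)
    rw [Real.norm_of_nonneg (hpos _).le, Real.norm_of_nonneg (hpos _).le]
    have : Real.exp (θ * (n + 1 : ℕ)) = Real.exp (θ * n) * ((1 + κ) / (2 * κ)) := by
      rw [← hθ, ← Real.exp_add]; push_cast; ring_nf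
    rw [this, fluxNat]
    have h2 : (w (-((n : ℤ) + 1)) / w ((n : ℤ) + 1)) * ((1 + κ) / (2 * κ)) ≤ (1 + κ) / 2 := by
      calc _ ≤ κ * ((1 + κ) / (2 * κ)) := mul_le_mul_of_nonneg_right hn (by positivity)
        _ = _ := by field_simp
    nlinarith [hpos n]
  refine Summable.of_nat_of_neg_add_one ?_ ?_
  · refine hs.congr fun n => ?_
    simp [flux]
  · refine (hs.mul_left (Real.exp θ)).congr fun n => ?_
    have : (-((n : ℤ) + 1)) = Int.negSucc n := by rw [Int.negSucc_eq]
    have habs : |((Int.negSucc n : ℤ) : ℝ)| = n + 1 := by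
      rw [← this]; push_cast; rw [abs_neg, abs_of_nonneg (by positivity)]
    rw [this, habs, flux, mul_add, Real.exp_add]
    ring_nf

/-- Density of the discrepancy at its visits, relative to the reversible measure. -/
def passDensity (w : ℤ → ℝ) (d : ℕ) (x : ℤ) : ℝ := shiftPass w d x / stat w x

section Convergence

variable {w : ℤ → ℝ}

lemma summable_flux (hw : GoodWeight w) : Summable (flux w) := by
  obtain ⟨θ, hθ, hs⟩ := exists_summable_flux_exp hw
  refine hs.of_nonneg_of_le (fun x => (flux_pos hw.1 x).le) fun x => ?_
  have : 1 ≤ Real.exp (θ * |(x : ℝ)|) := Real.one_le_exp (by positivity)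
  nlinarith [flux_pos hw.1 x]

lemma summable_flux_pred (hw : GoodWeight w) : Summable fun x => flux w (x - 1) :=
  (Equiv.subRight (1 : ℤ)).summable_iff.2 (summable_flux hw)

lemma summable_stat (hw : GoodWeight w) : Summable (stat w) :=
  (summable_flux hw).add (summable_flux_pred hw)

lemma passDensity_nonneg (hp : ∀ z, 0 < w z) (d : ℕ) (x : ℤ) : 0 ≤ passDensity w d x :=
  div_nonneg (shiftPass_nonneg hp d x) (stat_pos hp x).le

lemma passDensity_le_one (hp : ∀ z, 0 < w z) (d : ℕ) (x : ℤ) : passDensity w d x ≤ 1 :=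
  div_le_one_of_le₀ (shiftPass_le_stat hp d x) (stat_pos hp x).le

lemma stat_mul_passDensity (hp : ∀ z, 0 < w z) (d : ℕ) (x : ℤ) :
    stat w x * passDensity w d x = shiftPass w d x :=
  mul_div_cancel₀ _ (stat_pos hp x).ne'

lemma passDensity_succ (hp : ∀ z, 0 < w z) (d : ℕ) (x : ℤ) :
    passDensity w (d + 1) x =
      downProb w x * passDensity w (d + 1) (x - 1) + upProb w x * passDensity w d (x + 1) := by
  have h := shiftPass_succ (w := w) d x
  rw [← stat_mul_passDensity hp, ← stat_mul_passDensity hp, ← stat_mul_passDensity hp] at h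
  have h1 := stat_mul_upProb hp (x - 1)
  have h2 := stat_mul_downProb hp (x + 1)
  have h3 := stat_mul_upProb hp x
  have h4 := stat_mul_downProb hp x
  rw [add_sub_cancel_right] at h2
  apply mul_left_cancel₀ (stat_pos hp x).ne'
  linear_combination h + passDensity w (d + 1) (x - 1) * (h1 - h4) +
    passDensity w d (x + 1) * (h2 - h3)

/-- Weighted square norm of the density after a downward step. -/
def densityEnergy (w : ℤ → ℝ) (d : ℕ) : ℝ := ∑' x : ℤ, flux w (x - 1) * passDensity w d x ^ 2

/-- Dissipation of the energy, localised at `x`. -/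
def dissipation (w : ℤ → ℝ) (d : ℕ) (x : ℤ) : ℝ :=
  stat w x * (downProb w x * upProb w x) *
    (passDensity w (d + 1) (x - 1) - passDensity w d (x + 1)) ^ 2

lemma summable_mul_of_mem_Icc {f g : ℤ → ℝ} (hf : Summable f) (hf0 : ∀ x, 0 ≤ f x)
    (hg0 : ∀ x, 0 ≤ g x) (hg1 : ∀ x, g x ≤ 1) : Summable fun x => f x * g x :=
  hf.of_nonneg_of_le (fun x => mul_nonneg (hf0 x) (hg0 x))
    fun x => mul_le_of_le_one_right (hf0 x) (hg1 x)

lemma dissipation_nonneg (hp : ∀ z, 0 < w z) (d : ℕ) (x : ℤ) : 0 ≤ dissipation w d x :=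
  mul_nonneg (mul_nonneg (stat_pos hp x).le
    (mul_nonneg (downProb_pos hp x).le (upProb_pos hp x).le)) (sq_nonneg _)

lemma hasSum_dissipation (hw : GoodWeight w) (d : ℕ) :
    HasSum (dissipation w d) (densityEnergy w d - densityEnergy w (d + 1)) := by
  have hp := hw.1
  have hk0 := passDensity_nonneg hp
  have hk1 := passDensity_le_one hp
  have hs (d : ℕ) : Summable fun x => flux w (x - 1) * passDensity w d x ^ 2 :=
    summable_mul_of_mem_Icc (summable_flux_pred hw) (fun x => (flux_pos hp _).le)
      (fun x => sq_nonneg _) (fun x => pow_le_one₀ (hk0 _ _) (hk1 _ _))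
  have hs' : Summable fun x => flux w x * passDensity w (d + 1) x ^ 2 :=
    summable_mul_of_mem_Icc (summable_flux hw) (fun x => (flux_pos hp _).le)
      (fun x => sq_nonneg _) (fun x => pow_le_one₀ (hk0 _ _) (hk1 _ _))
  have e1 : HasSum (fun x => flux w (x - 1) * passDensity w (d + 1) (x - 1) ^ 2)
      (∑' x, flux w x * passDensity w (d + 1) x ^ 2) :=
    (Equiv.subRight (1 : ℤ)).hasSum_iff.2 hs'.hasSum
  have e2 : HasSum (fun x => flux w x * passDensity w d (x + 1) ^ 2) (densityEnergy w d) := by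
    have := (hs d).hasSum.comp_add_one
    refine this.of_fun_eq fun x => ?_
    rw [add_sub_cancel_right]
  have e3 := ((e1.add e2).sub (hs (d + 1)).hasSum).sub hs'.hasSum
  have e4 : densityEnergy w d - densityEnergy w (d + 1) =
      ∑' x, flux w x * passDensity w (d + 1) x ^ 2 + densityEnergy w d -
        ∑' x, flux w (x - 1) * passDensity w (d + 1) x ^ 2 -
        ∑' x, flux w x * passDensity w (d + 1) x ^ 2 := by
    rw [show densityEnergy w (d + 1) = ∑' x, flux w (x - 1) * passDensity w (d + 1) x ^ 2 from rfl]
    ring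
  rw [e4]
  refine e3.of_fun_eq fun x => ?_
  have h3 := stat_mul_upProb hp x
  have h4 := stat_mul_downProb hp x
  have h5 := upProb_add_downProb hp x
  have hk := passDensity_succ hp d x
  unfold dissipation
  have h6 : downProb w x = 1 - upProb w x := by linarith
  rw [h6] at hk h4 ⊢
  rw [hk, ← h3, ← h4]
  ring

lemma tendsto_dissipation (hw : GoodWeight w) (x : ℤ) :
    Tendsto (fun d => dissipation w d x) atTop (𝓝 0) := by
  have hanti : Antitone (densityEnergy w) := antitone_nat_of_succ_le fun d => by
    have := (hasSum_dissipation hw d).nonneg (dissipation_nonneg hw.1 d)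
    linarith
  have hbdd : BddBelow (Set.range (densityEnergy w)) :=
    ⟨0, by
      rintro _ ⟨d, rfl⟩
      exact tsum_nonneg fun x => mul_nonneg (flux_pos hw.1 _).le (sq_nonneg _)⟩
  have hlim := tendsto_atTop_ciInf hanti hbdd
  have hdiff := hlim.sub ((tendsto_add_atTop_iff_nat 1).2 hlim)
  rw [sub_self] at hdiff
  refine squeeze_zero (fun d => dissipation_nonneg hw.1 d x) (fun d => ?_) hdiff
  exact le_hasSum (hasSum_dissipation hw d) x fun y _ => dissipation_nonneg hw.1 d y

lemma tendsto_passDensity_sub_pred (hw : GoodWeight w) (x : ℤ) :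
    Tendsto (fun d => passDensity w d x - passDensity w d (x - 1)) atTop (𝓝 0) := by
  have hp := hw.1
  have hc : 0 < stat w x * (downProb w x * upProb w x) :=
    mul_pos (stat_pos hp x) (mul_pos (downProb_pos hp x) (upProb_pos hp x))
  have h1 : Tendsto (fun d =>
      (passDensity w (d + 1) (x - 1) - passDensity w d (x + 1)) ^ 2) atTop (𝓝 0) := by
    have := (tendsto_dissipation hw x).const_mul (stat w x * (downProb w x * upProb w x))⁻¹
    rw [mul_zero] at this
    refine this.congr fun d => ?_
    unfold dissipation
    rw [inv_mul_cancel_left₀ hc.ne']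
  have h2 : Tendsto (fun d =>
      passDensity w (d + 1) (x - 1) - passDensity w d (x + 1)) atTop (𝓝 0) := by
    rw [tendsto_zero_iff_abs_tendsto_zero]
    have := h1.sqrt
    simp only [Real.sqrt_zero, Real.sqrt_sq_eq_abs] at this
    exact this
  rw [← tendsto_add_atTop_iff_nat 1]
  have h3 := h2.const_mul (-upProb w x)
  rw [mul_zero] at h3
  refine h3.congr fun d => ?_
  have hk := passDensity_succ hp d x
  have h5 := upProb_add_downProb hp x
  linear_combination -hk - passDensity w (d + 1) (x - 1) * h5

lemma tendsto_passDensity_sub_zero (hw : GoodWeight w) (x : ℤ) :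
    Tendsto (fun d => passDensity w d x - passDensity w d 0) atTop (𝓝 0) := by
  induction x using Int.induction_on with
  | zero => simp
  | succ n ih =>
    have := (tendsto_passDensity_sub_pred hw (n + 1)).add ih
    rw [add_zero] at this
    refine this.congr fun d => ?_
    rw [add_sub_cancel_right]; ring
  | pred n ih =>
    have := ih.sub (tendsto_passDensity_sub_pred hw (-n))
    rw [sub_zero] at this
    refine this.congr fun d => ?_
    ring

/-- The law of the discrepancy right after a downward step. -/
lemma shiftPass_mul_downProb (hp : ∀ z, 0 < w z) (d : ℕ) (x : ℤ) :
    shiftPass w d (x + 1) * downProb w (x + 1) = flux w x * passDensity w d (x + 1) := by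
  have h2 := stat_mul_downProb hp (x + 1)
  rw [add_sub_cancel_right] at h2
  rw [← stat_mul_passDensity hp, ← h2]
  ring

lemma hasSum_flux_mul_passDensity (hw : GoodWeight w) (d : ℕ) :
    HasSum (fun x => flux w x * passDensity w d (x + 1)) 1 := by
  have hp := hw.1
  have hsp (d : ℕ) : Summable (shiftPass w d) :=
    (summable_stat hw).of_nonneg_of_le (shiftPass_nonneg hp d) (shiftPass_le_stat hp d)
  have hu1 (x : ℤ) : upProb w x ≤ 1 := by
    linarith [upProb_add_downProb hp x, downProb_pos hp x]
  have hup (d : ℕ) : Summable fun x => shiftPass w d x * upProb w x :=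
    summable_mul_of_mem_Icc (hsp d) (shiftPass_nonneg hp d) (fun x => (upProb_pos hp x).le) hu1
  have hdn (d : ℕ) : HasSum (fun x => shiftPass w d x * downProb w x)
      (∑' x, shiftPass w d x - ∑' x, shiftPass w d x * upProb w x) := by
    refine ((hsp d).hasSum.sub (hup d).hasSum).of_fun_eq fun x => ?_
    linear_combination (shiftPass w d x) * upProb_add_downProb hp x
  have hup' (d : ℕ) : HasSum (fun x => shiftPass w d (x - 1) * upProb w (x - 1))
      (∑' x, shiftPass w d x * upProb w x) :=
    (hup d).hasSum.comp_sub_one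
  have hmass : HasSum (fun x => shiftPass w d x * downProb w x) 1 := by
    induction d with
    | zero =>
      have h0 : HasSum (fun x : ℤ => if x = 0 then (1 : ℝ) else 0) 1 := by
        simpa using hasSum_ite_eq (0 : ℤ) (1 : ℝ)
      have h1 : HasSum (shiftPass w 0) (∑' x, shiftPass w 0 x * upProb w x + 1) :=
        ((hup' 0).add h0).of_fun_eq shiftPass_zero
      have := hdn 0
      rw [h1.tsum_eq] at this
      simpa using this
    | succ d ih =>
      have h0 : HasSum (fun x : ℤ => shiftPass w d (x + 1) * downProb w (x + 1)) 1 :=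
        ih.comp_add_one
      have h1 : HasSum (shiftPass w (d + 1))
          (∑' x, shiftPass w (d + 1) x * upProb w x + 1) :=
        ((hup' (d + 1)).add h0).of_fun_eq (shiftPass_succ d)
      have := hdn (d + 1)
      rw [h1.tsum_eq] at this
      simpa using this
  exact hmass.comp_add_one.of_fun_eq fun x => (shiftPass_mul_downProb hp d x).symm

/-- Averages against the law of the discrepancy converge to multiples of the stationary ones. -/
lemma tendsto_tsum_sub (hw : GoodWeight w) {F : ℤ → ℝ}
    (hF : Summable fun x => flux w x * |F x|) :
    Tendsto (fun d => ∑' x, flux w x * F x * (passDensity w d (x + 1) - passDensity w d 0))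
      atTop (𝓝 0) := by
  have hp := hw.1
  have : Tendsto (fun d => ∑' x, flux w x * F x *
      (passDensity w d (x + 1) - passDensity w d 0)) atTop (𝓝 (∑' _ : ℤ, 0)) := by
    refine tendsto_tsum_of_dominated_convergence hF (fun x => ?_) (Eventually.of_forall ?_)
    · simpa using (tendsto_passDensity_sub_zero hw (x + 1)).const_mul (flux w x * F x)
    · intro d x
      rw [norm_mul, norm_mul, Real.norm_of_nonneg (flux_pos hp x).le, Real.norm_eq_abs,
        Real.norm_eq_abs]
      refine mul_le_of_le_one_right (mul_nonneg (flux_pos hp x).le (abs_nonneg _)) ?_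
      have h1 := passDensity_nonneg hp d (x + 1)
      have h2 := passDensity_nonneg hp d 0
      have h3 := passDensity_le_one hp d (x + 1)
      have h4 := passDensity_le_one hp d 0
      rw [abs_le]; constructor <;> linarith
  simpa using this

lemma tendsto_passDensity_zero (hw : GoodWeight w) :
    Tendsto (fun d => passDensity w d 0) atTop (𝓝 (∑' x, flux w x)⁻¹) := by
  have hs := summable_flux hw
  have hZ : 0 < ∑' x, flux w x := hs.tsum_pos (fun x => (flux_pos hw.1 x).le) 0 (flux_pos hw.1 0)
  have h := tendsto_tsum_sub hw (F := fun _ => 1) (by simpa using hs)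
  have h' : Tendsto (fun d => 1 - (∑' x, flux w x) * passDensity w d 0) atTop (𝓝 0) := by
    refine h.congr fun d => ?_
    have h1 := hasSum_flux_mul_passDensity hw d
    refine ((h1.sub (hs.hasSum.mul_right (passDensity w d 0))).of_fun_eq fun x => ?_).tsum_eq
    ring
  have h2 := (h'.const_sub 1).const_mul (∑' x, flux w x)⁻¹
  rw [sub_zero, mul_one] at h2
  refine h2.congr fun d => ?_
  rw [sub_sub_cancel, inv_mul_cancel_left₀ hZ.ne']

end Convergence

/-! ### Moments of the round kernel -/

section Moments

variable {w : ℤ → ℝ}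

lemma roundKernel_succ_eq (hp : ∀ z, 0 < w z) (d e : ℕ) :
    roundKernel w (d + 1) e =
      flux w ((e : ℤ) - (d + 1)) * passDensity w d ((e : ℤ) - (d + 1) + 1) := by
  rw [← shiftPass_mul_downProb hp, roundKernel, ← shiftPass_natCast_sub]
  ring_nf

/-- Transfer of sums from discrepancies to numbers of upward steps. -/
lemma HasSum.roundKernel_of_flux (hp : ∀ z, 0 < w z) {d : ℕ} {F : ℤ → ℝ} {a : ℝ}
    (h : HasSum (fun x => flux w x * passDensity w d (x + 1) * F x) a) :
    HasSum (fun e : ℕ => roundKernel w (d + 1) e * F ((e : ℤ) - (d + 1))) a := by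
  have hinj : Function.Injective fun e : ℕ => (e : ℤ) - (d + 1) := fun a b h => by
    simp only at h; omega
  have hz : ∀ x ∉ Set.range fun e : ℕ => (e : ℤ) - (d + 1),
      flux w x * passDensity w d (x + 1) * F x = 0 := by
    intro x hx
    have : x + 1 + d < 0 := by
      by_contra hlt
      exact hx ⟨(x + 1 + d).toNat, by simp only; omega⟩
    simp [passDensity, shiftPass_of_lt this]
  refine ((hinj.hasSum_iff hz).2 h).of_fun_eq fun e => ?_
  simp only [Function.comp_apply]
  rw [roundKernel_succ_eq hp]

lemma exp_neg_le (y : ℝ) : Real.exp (-y) ≤ 1 - y + y ^ 2 * Real.exp |y| := by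
  have h1 := Real.add_one_le_exp y
  have h2 : Real.exp (-y) * Real.exp y = 1 := by rw [← Real.exp_add]; simp
  have h3 := Real.add_one_le_exp (-y)
  have hpos := Real.exp_pos (-y)
  have h4 : Real.exp (-y) - 1 ≤ -y * Real.exp (-y) := by nlinarith
  have h5 : -y * (Real.exp (-y) - 1) ≤ y ^ 2 * Real.exp |y| := by
    rcases le_total 0 y with hy | hy
    · have : 1 ≤ Real.exp |y| := Real.one_le_exp (abs_nonneg _)
      nlinarith
    · rw [abs_of_nonpos hy]
      nlinarith
  linarith

lemma exists_moment_bound (hw : GoodWeight w) :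
    ∃ θ : ℝ, 0 < θ ∧ Summable fun x : ℤ => flux w x * ((x : ℝ) ^ 2 * Real.exp (θ * |(x : ℝ)|)) := by
  obtain ⟨θ, hθ, hs⟩ := exists_summable_flux_exp hw
  refine ⟨θ / 2, by positivity, ?_⟩
  refine (hs.mul_left (2 * (2 / θ) ^ 2)).of_nonneg_of_le
    (fun x => mul_nonneg (flux_pos hw.1 x).le (by positivity)) fun x => ?_
  have h1 : (θ / 2 * |(x : ℝ)|) ^ 2 / 2 ≤ Real.exp (θ / 2 * |(x : ℝ)|) := by
    have := Real.quadratic_le_exp_of_nonneg (x := θ / 2 * |(x : ℝ)|) (by positivity)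
    have : 0 ≤ θ / 2 * |(x : ℝ)| := by positivity
    linarith
  have h2 : Real.exp (θ * |(x : ℝ)|) =
      Real.exp (θ / 2 * |(x : ℝ)|) * Real.exp (θ / 2 * |(x : ℝ)|) := by
    rw [← Real.exp_add]; ring_nf
  have h3 : (x : ℝ) ^ 2 = 2 * (2 / θ) ^ 2 * ((θ / 2 * |(x : ℝ)|) ^ 2 / 2) := by
    rw [mul_pow, sq_abs]; field_simp
  rw [h2, h3]
  have hf := (flux_pos hw.1 x).le
  have hc : 0 ≤ 2 * (2 / θ) ^ 2 := by positivity
  calc _ = flux w x * (2 * (2 / θ) ^ 2) * ((θ / 2 * |(x : ℝ)|) ^ 2 / 2 *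
        Real.exp (θ / 2 * |(x : ℝ)|)) := by ring
    _ ≤ flux w x * (2 * (2 / θ) ^ 2) * (Real.exp (θ / 2 * |(x : ℝ)|) *
        Real.exp (θ / 2 * |(x : ℝ)|)) := by gcongr
    _ = _ := by ring

lemma summable_flux_abs (hw : GoodWeight w) : Summable fun x : ℤ => flux w x * |(x : ℝ)| := by
  obtain ⟨θ, hθ, hs⟩ := exists_summable_flux_exp hw
  refine (hs.mul_left θ⁻¹).of_nonneg_of_le
    (fun x => mul_nonneg (flux_pos hw.1 x).le (by positivity)) fun x => ?_
  have h1 := Real.add_one_le_exp (θ * |(x : ℝ)|)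
  have hf := (flux_pos hw.1 x).le
  calc flux w x * |(x : ℝ)| = θ⁻¹ * (flux w x * (θ * |(x : ℝ)|)) := by field_simp
    _ ≤ _ := by gcongr; linarith

/-- Mean discrepancy after a round with `d + 1` downward steps. -/
def meanShift (w : ℤ → ℝ) (d : ℕ) : ℝ := ∑' x : ℤ, flux w x * passDensity w d (x + 1) * x

lemma summable_meanShift (hw : GoodWeight w) (d : ℕ) :
    Summable fun x : ℤ => flux w x * passDensity w d (x + 1) * x := by
  refine (summable_flux_abs hw).of_norm_bounded fun x => ?_
  have hf := (flux_pos hw.1 x).le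
  have h0 := passDensity_nonneg hw.1 d (x + 1)
  rw [norm_mul, norm_mul, Real.norm_of_nonneg hf, Real.norm_of_nonneg h0, Real.norm_eq_abs]
  have := passDensity_le_one hw.1 d (x + 1)
  gcongr
  exact mul_le_of_le_one_right hf this

lemma meanShift_le (hw : GoodWeight w) (d : ℕ) :
    meanShift w d ≤ ∑' x : ℤ, flux w x * |(x : ℝ)| := by
  refine (summable_meanShift hw d).tsum_le_tsum (fun x => ?_) (summable_flux_abs hw)
  have hf := (flux_pos hw.1 x).le
  have h0 := passDensity_nonneg hw.1 d (x + 1)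
  have h1 := passDensity_le_one hw.1 d (x + 1)
  calc flux w x * passDensity w d (x + 1) * x
      ≤ flux w x * passDensity w d (x + 1) * |(x : ℝ)| := by gcongr; exact le_abs_self _
    _ ≤ _ := by gcongr; exact mul_le_of_le_one_right hf h1

lemma tendsto_meanShift (hw : GoodWeight w) :
    Tendsto (meanShift w) atTop (𝓝 (-(1 / 2))) := by
  have hs := summable_flux hw
  have hZ : 0 < ∑' x, flux w x := hs.tsum_pos (fun x => (flux_pos hw.1 x).le) 0 (flux_pos hw.1 0)
  have hx : Summable fun x : ℤ => flux w x * x := by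
    refine (summable_flux_abs hw).of_norm_bounded fun x => ?_
    rw [norm_mul, Real.norm_of_nonneg (flux_pos hw.1 x).le, Real.norm_eq_abs]
  have hsym : ∑' x : ℤ, flux w x * x = -(1 / 2) * ∑' x, flux w x := by
    have h1 : ∑' x : ℤ, flux w x * x = ∑' x : ℤ, (-flux w x - flux w x * x) := by
      rw [← (Equiv.subLeft (-1 : ℤ)).tsum_eq]
      refine tsum_congr fun x => ?_
      rw [Equiv.subLeft_apply, flux_reflect]
      push_cast; ring
    rw [hs.neg.tsum_sub hx, tsum_neg] at h1
    linarith
  have h1 := tendsto_tsum_sub hw (F := fun x => (x : ℝ)) (summable_flux_abs hw)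
  have h2 := (tendsto_passDensity_zero hw).const_mul (∑' x : ℤ, flux w x * x)
  have h3 := h1.add h2
  have h4 : 0 + (∑' x : ℤ, flux w x * x) * (∑' x, flux w x)⁻¹ = -(1 / 2) := by
    rw [hsym]; field_simp; ring
  rw [h4] at h3
  refine h3.congr fun d => ?_
  rw [← tsum_mul_right, ← Summable.tsum_add ?_ (hx.mul_right _)]
  · exact tsum_congr fun x => by ring
  · exact ((summable_meanShift hw d).sub (hx.mul_right (passDensity w d 0))).congr
      fun x => by ring

lemma hasSum_roundKernel (hw : GoodWeight w) (d : ℕ) : HasSum (roundKernel w d) 1 := by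
  cases d with
  | zero => exact (hasSum_ite_eq 0 1).of_fun_eq fun e => rfl
  | succ d =>
    refine (HasSum.roundKernel_of_flux hw.1 (F := fun _ => 1) ?_).of_fun_eq fun e => by ring
    exact (hasSum_flux_mul_passDensity hw d).of_fun_eq fun x => by ring

lemma hasSum_roundKernel_mul (hw : GoodWeight w) (d : ℕ) :
    HasSum (fun e : ℕ => roundKernel w (d + 1) e * e) (d + 1 + meanShift w d) := by
  have h1 := (summable_meanShift hw d).hasSum.roundKernel_of_flux hw.1 (F := fun x => (x : ℝ))
  have h2 := (hasSum_roundKernel hw (d + 1)).mul_left ((d : ℝ) + 1)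
  rw [mul_one] at h2
  refine (h2.add h1).of_fun_eq fun e => ?_
  push_cast; ring

lemma exists_roundKernel_exp_le (hw : GoodWeight w) {δ : ℝ} (hδ : 0 < δ) :
    ∃ θ : ℝ, 0 < θ ∧ ∃ d₁ : ℕ, ∀ d, d₁ ≤ d → ∃ S, S ≤ Real.exp (θ * (1 / 2 + δ) - θ * d) ∧
      HasSum (fun e : ℕ => roundKernel w d e * Real.exp (-(θ * e))) S := by
  have hp := hw.1
  obtain ⟨θ₀, hθ₀, hV⟩ := exists_moment_bound hw
  set V := ∑' x : ℤ, flux w x * ((x : ℝ) ^ 2 * Real.exp (θ₀ * |(x : ℝ)|)) with hVdef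
  have hV0 : 0 ≤ V := tsum_nonneg fun x => mul_nonneg (flux_pos hp x).le (by positivity)
  set θ := min θ₀ (δ / 2 / (V + 1)) with hθdef
  have hθ : 0 < θ := lt_min hθ₀ (by positivity)
  have hθV : θ * V ≤ δ / 2 := by
    have h1 : θ ≤ δ / 2 / (V + 1) := min_le_right _ _
    rw [le_div_iff₀ (by positivity)] at h1
    nlinarith
  have hev : ∀ᶠ d in atTop, -(1 / 2) - δ / 2 < meanShift w d :=
    (tendsto_meanShift hw).eventually_const_lt (by linarith)
  obtain ⟨d₀, hd₀⟩ := eventually_atTop.1 hev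
  refine ⟨θ, hθ, d₀ + 1, fun d hd => ?_⟩
  obtain ⟨d, rfl⟩ : ∃ d', d = d' + 1 := ⟨d - 1, by omega⟩
  have hm := hd₀ d (by omega)
  have hG0 (x : ℤ) : 0 ≤ flux w x * passDensity w d (x + 1) :=
    mul_nonneg (flux_pos hp x).le (passDensity_nonneg hp d _)
  have hG1 (x : ℤ) : flux w x * passDensity w d (x + 1) ≤ flux w x :=
    mul_le_of_le_one_right (flux_pos hp x).le (passDensity_le_one hp d _)
  have hsq : Summable fun x : ℤ => flux w x * passDensity w d (x + 1) *
      ((x : ℝ) ^ 2 * Real.exp (θ₀ * |(x : ℝ)|)) :=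
    hV.of_nonneg_of_le (fun x => mul_nonneg (hG0 x) (by positivity))
      fun x => mul_le_mul_of_nonneg_right (hG1 x) (by positivity)
  have hsqV : ∑' x : ℤ, flux w x * passDensity w d (x + 1) *
      ((x : ℝ) ^ 2 * Real.exp (θ₀ * |(x : ℝ)|)) ≤ V :=
    hsq.tsum_le_tsum (fun x => mul_le_mul_of_nonneg_right (hG1 x) (by positivity)) hV
  have hU := ((hasSum_flux_mul_passDensity hw d).sub
    ((summable_meanShift hw d).hasSum.mul_left θ)).add (hsq.hasSum.mul_left (θ ^ 2))
  have hle (x : ℤ) : flux w x * passDensity w d (x + 1) * Real.exp (-(θ * x)) ≤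
      flux w x * passDensity w d (x + 1) - θ * (flux w x * passDensity w d (x + 1) * x) +
        θ ^ 2 * (flux w x * passDensity w d (x + 1) *
          ((x : ℝ) ^ 2 * Real.exp (θ₀ * |(x : ℝ)|))) := by
    have h1 := exp_neg_le (θ * x)
    have h2 : Real.exp |θ * x| ≤ Real.exp (θ₀ * |(x : ℝ)|) := by
      rw [abs_mul, abs_of_pos hθ]
      gcongr
      exact min_le_left _ _
    have h3 : Real.exp (-(θ * x)) ≤
        1 - θ * x + (θ * x) ^ 2 * Real.exp (θ₀ * |(x : ℝ)|) := by
      refine h1.trans ?_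
      gcongr
    calc _ ≤ flux w x * passDensity w d (x + 1) *
          (1 - θ * x + (θ * x) ^ 2 * Real.exp (θ₀ * |(x : ℝ)|)) :=
          mul_le_mul_of_nonneg_left h3 (hG0 x)
      _ = _ := by ring
  have hexp : Summable fun x : ℤ => flux w x * passDensity w d (x + 1) * Real.exp (-(θ * x)) :=
    hU.summable.of_nonneg_of_le (fun x => mul_nonneg (hG0 x) (Real.exp_pos _).le) hle
  have hbound : ∑' x : ℤ, flux w x * passDensity w d (x + 1) * Real.exp (-(θ * x)) ≤
      Real.exp (θ * (1 / 2 + δ)) := by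
    refine (hasSum_le hle hexp.hasSum hU).trans ?_
    rw [← meanShift]
    refine le_trans ?_ (Real.add_one_le_exp _)
    have h1 : θ ^ 2 * ∑' x : ℤ, flux w x * passDensity w d (x + 1) *
        ((x : ℝ) ^ 2 * Real.exp (θ₀ * |(x : ℝ)|)) ≤ θ * (δ / 2) := by
      rw [sq, mul_assoc]
      gcongr
      exact (mul_le_mul_of_nonneg_left hsqV hθ.le).trans hθV
    nlinarith
  refine ⟨Real.exp (-(θ * (d + 1))) *
    ∑' x : ℤ, flux w x * passDensity w d (x + 1) * Real.exp (-(θ * x)), ?_, ?_⟩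
  · rw [show θ * (1 / 2 + δ) - θ * ((d + 1 : ℕ) : ℝ) = -(θ * (d + 1)) + θ * (1 / 2 + δ) by
      push_cast; ring, Real.exp_add]
    gcongr
  · refine ((hexp.hasSum.roundKernel_of_flux hp (F := fun x => Real.exp (-(θ * x)))).mul_left
      (Real.exp (-(θ * (d + 1))))).of_fun_eq fun e => ?_
    rw [mul_left_comm, ← Real.exp_add]
    push_cast
    ring_nf

end Moments

/-! ### The chain of local times -/

/-- The round kernel with values in `ℝ≥0∞`. -/
def roundMass (w : ℤ → ℝ) (d e : ℕ) : ℝ≥0∞ := ENNReal.ofReal (roundKernel w d e)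

/-- Law after `i` rounds of the chain started at `r₀` with one immigrant in each of the first `J`
rounds. -/
def chainLaw (w : ℤ → ℝ) (r₀ J : ℕ) : ℕ → ℕ → ℝ≥0∞
  | 0, e => if e = r₀ then 1 else 0
  | i + 1, e => ∑' d, chainLaw w r₀ J i d * roundMass w (d + if i < J then 1 else 0) e

/-- The exponential test function `min 1 (exp (θ (c - d)))`. -/
def cappedExp (θ c : ℝ) (d : ℕ) : ℝ≥0∞ := min 1 (ENNReal.ofReal (Real.exp (θ * (c - d))))

section Chain

variable {w : ℤ → ℝ}

lemma tsum_roundMass_mul (hp : ∀ z, 0 < w z) {d : ℕ} {f : ℕ → ℝ} (hf : ∀ e, 0 ≤ f e) {S : ℝ}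
    (h : HasSum (fun e => roundKernel w d e * f e) S) :
    ∑' e, roundMass w d e * ENNReal.ofReal (f e) = ENNReal.ofReal S := by
  rw [← h.tsum_eq, ENNReal.ofReal_tsum_of_nonneg
    (fun e => mul_nonneg (roundKernel_nonneg hp d e) (hf e)) h.summable]
  exact tsum_congr fun e => (ENNReal.ofReal_mul (roundKernel_nonneg hp d e)).symm

lemma tsum_roundMass (hw : GoodWeight w) (d : ℕ) : ∑' e, roundMass w d e = 1 := by
  have := tsum_roundMass_mul hw.1 (d := d) (f := fun _ => 1) (fun _ => zero_le_one)
    ((hasSum_roundKernel hw d).of_fun_eq fun e => mul_one _)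
  simpa using this

lemma tsum_chainLaw_zero (r₀ J : ℕ) (f : ℕ → ℝ≥0∞) :
    ∑' e, chainLaw w r₀ J 0 e * f e = f r₀ := by
  rw [tsum_eq_single r₀ fun e he => by simp [chainLaw, he]]
  simp [chainLaw]

lemma tsum_chainLaw_succ (r₀ J i : ℕ) (f : ℕ → ℝ≥0∞) :
    ∑' e, chainLaw w r₀ J (i + 1) e * f e =
      ∑' d, chainLaw w r₀ J i d *
        ∑' e, roundMass w (d + if i < J then 1 else 0) e * f e := by
  simp only [chainLaw, ← ENNReal.tsum_mul_right, ← ENNReal.tsum_mul_left]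
  rw [ENNReal.tsum_comm]
  exact tsum_congr fun d => tsum_congr fun e => mul_assoc _ _ _

lemma tsum_chainLaw (hw : GoodWeight w) (r₀ J i : ℕ) : ∑' e, chainLaw w r₀ J i e = 1 := by
  suffices ∑' e, chainLaw w r₀ J i e * 1 = 1 by simpa using this
  induction i with
  | zero => exact tsum_chainLaw_zero r₀ J _
  | succ i ih => rw [tsum_chainLaw_succ]; simpa [tsum_roundMass hw] using ih

lemma cappedExp_mono {θ c c' : ℝ} (hθ : 0 < θ) (h : c ≤ c') (d : ℕ) :
    cappedExp θ c d ≤ cappedExp θ c' d := by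
  unfold cappedExp
  gcongr

lemma cappedExp_eq_one {θ c : ℝ} (hθ : 0 < θ) {d : ℕ} (h : (d : ℝ) ≤ c) :
    cappedExp θ c d = 1 := by
  unfold cappedExp
  rw [min_eq_left]
  rw [ENNReal.one_le_ofReal]
  exact Real.one_le_exp (mul_nonneg hθ.le (by linarith))

/-- One-step estimate for the lower tail of the round kernel. -/
def ExpDrift (w : ℤ → ℝ) (δ θ : ℝ) (d₁ : ℕ) : Prop :=
  ∀ d : ℕ, ∀ c : ℝ, (d₁ : ℝ) ≤ c →
    ∑' e, roundMass w d e * cappedExp θ c e ≤ cappedExp θ (c + (1 / 2 + δ)) d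

lemma exists_expDrift (hw : GoodWeight w) {δ : ℝ} (hδ : 0 < δ) :
    ∃ θ : ℝ, 0 < θ ∧ ∃ d₁ : ℕ, ExpDrift w δ θ d₁ := by
  obtain ⟨θ, hθ, d₁, H⟩ := exists_roundKernel_exp_le hw hδ
  refine ⟨θ, hθ, d₁, fun d c hc => ?_⟩
  have h1 : ∑' e, roundMass w d e * cappedExp θ c e ≤ 1 := by
    rw [← tsum_roundMass hw d]
    exact ENNReal.tsum_le_tsum fun e => mul_le_of_le_one_right' (min_le_left _ _)
  rcases lt_or_ge d d₁ with hd | hd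
  · rw [cappedExp_eq_one hθ]
    · exact h1
    · have : (d : ℝ) ≤ d₁ := by exact_mod_cast hd.le
      linarith
  · refine le_min h1 ?_
    obtain ⟨S, hS, hsum⟩ := H d hd
    have h2 := tsum_roundMass_mul hw.1 (f := fun e : ℕ => Real.exp (θ * (c - e)))
      (fun e => (Real.exp_pos _).le) (S := Real.exp (θ * c) * S)
      ((hsum.mul_left (Real.exp (θ * c))).of_fun_eq fun e => by
        rw [mul_left_comm, ← Real.exp_add]; ring_nf)
    calc ∑' e, roundMass w d e * cappedExp θ c e
        ≤ ∑' e, roundMass w d e * ENNReal.ofReal (Real.exp (θ * (c - e))) :=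
          ENNReal.tsum_le_tsum fun e => mul_le_mul_right (min_le_right _ _) _
      _ = ENNReal.ofReal (Real.exp (θ * c) * S) := h2
      _ ≤ _ := by
        apply ENNReal.ofReal_le_ofReal
        calc Real.exp (θ * c) * S
            ≤ Real.exp (θ * c) * Real.exp (θ * (1 / 2 + δ) - θ * d) := by gcongr
          _ = _ := by rw [← Real.exp_add]; ring_nf

lemma tsum_chainLaw_cappedExp_le_of_le {δ θ : ℝ} {d₁ : ℕ}
    (H : ExpDrift w δ θ d₁) (r₀ J : ℕ) (n : ℕ) (hδ : 0 < δ) :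
    ∑' e, chainLaw w r₀ J (J + n) e * cappedExp θ d₁ e ≤
      ∑' e, chainLaw w r₀ J J e * cappedExp θ (d₁ + n * (1 / 2 + δ)) e := by
  suffices ∀ c : ℝ, (d₁ : ℝ) ≤ c → ∑' e, chainLaw w r₀ J (J + n) e * cappedExp θ c e ≤
      ∑' e, chainLaw w r₀ J J e * cappedExp θ (c + n * (1 / 2 + δ)) e from this _ le_rfl
  induction n with
  | zero => intro c hc; simp
  | succ n ih =>
    intro c hc
    rw [← add_assoc, tsum_chainLaw_succ]
    have h1 := ih (c + (1 / 2 + δ)) (by linarith)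
    rw [show c + (1 / 2 + δ) + n * (1 / 2 + δ) = c + ((n + 1 : ℕ) : ℝ) * (1 / 2 + δ) by
      push_cast; ring] at h1
    refine le_trans (ENNReal.tsum_le_tsum fun d => mul_le_mul_right ?_ _) h1
    rw [if_neg (by omega)]
    exact H d c hc

lemma tsum_chainLaw_cappedExp_le {δ θ : ℝ} {d₁ : ℕ} (hθ : 0 < θ)
    (H : ExpDrift w δ θ d₁) (hδ : δ < 1 / 2) (r₀ J : ℕ) {i : ℕ} (hi : i ≤ J) (c : ℝ)
    (hc : (d₁ : ℝ) ≤ c) :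
    ∑' e, chainLaw w r₀ J i e * cappedExp θ c e ≤
      cappedExp θ (max (c - i * (1 / 2 - δ)) d₁) r₀ := by
  induction i generalizing c with
  | zero =>
    rw [tsum_chainLaw_zero]
    exact cappedExp_mono hθ (by simp) _
  | succ i ih =>
    rw [tsum_chainLaw_succ]
    refine le_trans (ENNReal.tsum_le_tsum fun d => mul_le_mul_right ?_ _)
      ((ih (by omega) (max (c - (1 / 2 - δ)) d₁) (le_max_right _ _)).trans
        (cappedExp_mono hθ ?_ _))
    · rw [if_pos (by omega)]
      refine (H (d + 1) c hc).trans ?_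
      refine le_trans (le_of_eq ?_) (cappedExp_mono hθ (le_max_left _ _) _)
      unfold cappedExp
      push_cast
      ring_nf
    · have h0 : (0 : ℝ) ≤ i * (1 / 2 - δ) := mul_nonneg (by positivity) (by linarith)
      have h1 := le_max_left (c - ((i + 1 : ℕ) : ℝ) * (1 / 2 - δ)) (d₁ : ℝ)
      have h2 := le_max_right (c - ((i + 1 : ℕ) : ℝ) * (1 / 2 - δ)) (d₁ : ℝ)
      refine max_le ?_ h2
      rw [sub_le_iff_le_add]
      push_cast at h1 h2 ⊢
      exact max_le (by linarith) (by linarith)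

/-- Exponential bound for the probability that the chain vanishes. -/
lemma chainLaw_zero_le {δ θ : ℝ} {d₁ : ℕ} (hθ : 0 < θ)
    (H : ExpDrift w δ θ d₁) (hδ0 : 0 < δ) (hδ : δ < 1 / 2) (r₀ J n : ℕ) :
    chainLaw w r₀ J (J + n) 0 ≤ ENNReal.ofReal (Real.exp (θ *
      (max (d₁ + n * (1 / 2 + δ) - J * (1 / 2 - δ)) d₁ - r₀))) := by
  have h1 : chainLaw w r₀ J (J + n) 0 ≤ ∑' e, chainLaw w r₀ J (J + n) e * cappedExp θ d₁ e := by
    refine le_trans (le_of_eq ?_) (ENNReal.le_tsum 0)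
    rw [cappedExp_eq_one hθ (by simp), mul_one]
  refine h1.trans ((tsum_chainLaw_cappedExp_le_of_le H r₀ J n hδ0).trans
    ((tsum_chainLaw_cappedExp_le hθ H hδ r₀ J le_rfl _ ?_).trans (min_le_right _ _)))
  have : (0 : ℝ) ≤ n * (1 / 2 + δ) := by positivity
  linarith

lemma tsum_chainLaw_indicator_le {δ θ : ℝ} {d₁ : ℕ} (hθ : 0 < θ)
    (H : ExpDrift w δ θ d₁) (hδ : δ < 1 / 2) (r₀ J : ℕ) {i : ℕ} (hi : i ≤ J) :
    ∑' e, chainLaw w r₀ J i e * (if e < d₁ then 1 else 0) ≤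
      ENNReal.ofReal (Real.exp (θ * (d₁ - r₀))) := by
  refine le_trans (ENNReal.tsum_le_tsum fun e => mul_le_mul_right ?_ _)
    ((tsum_chainLaw_cappedExp_le hθ H hδ r₀ J hi d₁ le_rfl).trans ?_)
  · split_ifs with he
    · rw [cappedExp_eq_one hθ (by exact_mod_cast he.le)]
    · exact zero_le
  · refine (min_le_right _ _).trans (le_of_eq ?_)
    rw [max_eq_right]
    have : (0 : ℝ) ≤ i * (1 / 2 - δ) := mul_nonneg (by positivity) (by linarith)
    linarith

lemma exists_mean_le (hw : GoodWeight w) {δ : ℝ} (hδ : 0 < δ) (d₁ : ℕ) :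
    ∃ C : ℝ, 0 < C ∧ ∃ d₀, d₁ ≤ d₀ ∧ ∀ d : ℕ, HasSum (fun e : ℕ => roundKernel w (d + 1) e * e)
        (d + 1 + meanShift w d) ∧ d + 1 + meanShift w d ≤ d + (1 / 2 + δ) +
          (if d < d₀ then C else 0) := by
  have hev : ∀ᶠ d in atTop, meanShift w d < -(1 / 2) + δ :=
    (tendsto_meanShift hw).eventually_lt_const (by linarith)
  obtain ⟨d₀, hd₀⟩ := eventually_atTop.1 hev
  refine ⟨1 + ∑' x : ℤ, flux w x * |(x : ℝ)|, ?_, max d₀ d₁, le_max_right _ _,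
    fun d => ⟨hasSum_roundKernel_mul hw d, ?_⟩⟩
  · have : 0 ≤ ∑' x : ℤ, flux w x * |(x : ℝ)| :=
      tsum_nonneg fun x => mul_nonneg (flux_pos hw.1 x).le (abs_nonneg _)
    linarith
  · split_ifs with h
    · linarith [meanShift_le hw d]
    · have := hd₀ d ((le_max_left _ _).trans (not_lt.1 h))
      linarith

lemma tsum_chainLaw_mean_le (hw : GoodWeight w) {δ C : ℝ} {d₀ : ℕ} (hδ : 0 < δ) (hC : 0 < C)
    (hm : ∀ d : ℕ, HasSum (fun e : ℕ => roundKernel w (d + 1) e * e)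
        (d + 1 + meanShift w d) ∧ d + 1 + meanShift w d ≤ d + (1 / 2 + δ) +
          (if d < d₀ then C else 0)) {r₀ J : ℕ} {q : ℝ} (hq : 0 ≤ q)
    (hsmall : ∀ i ≤ J, ∑' e, chainLaw w r₀ J i e * (if e < d₀ then 1 else 0) ≤
      ENNReal.ofReal q) {i : ℕ} (hi : i ≤ J) :
    ∑' e : ℕ, chainLaw w r₀ J i e * ENNReal.ofReal e ≤
      ENNReal.ofReal (r₀ + i * (1 / 2 + δ + C * q)) := by
  induction i with
  | zero => rw [tsum_chainLaw_zero]; simp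
  | succ i ih =>
    rw [tsum_chainLaw_succ]
    have h1 (d : ℕ) : ∑' e : ℕ, roundMass w (d + 1) e * ENNReal.ofReal e ≤
        ENNReal.ofReal d + ENNReal.ofReal (1 / 2 + δ) +
          ENNReal.ofReal C * (if d < d₀ then 1 else 0) := by
      rw [tsum_roundMass_mul hw.1 (f := fun e : ℕ => (e : ℝ)) (fun e => by positivity) (hm d).1]
      refine (ENNReal.ofReal_le_ofReal (hm d).2).trans (le_of_eq ?_)
      rw [ENNReal.ofReal_add (by positivity) (by split_ifs <;> linarith),
        ENNReal.ofReal_add (by positivity) (by positivity)]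
      split_ifs <;> simp
    calc _ ≤ ∑' d : ℕ, chainLaw w r₀ J i d * (ENNReal.ofReal d + ENNReal.ofReal (1 / 2 + δ) +
          ENNReal.ofReal C * (if d < d₀ then 1 else 0)) := by
          refine ENNReal.tsum_le_tsum fun d => mul_le_mul_right ?_ _
          rw [if_pos (by omega)]
          exact h1 d
      _ = ∑' d : ℕ, chainLaw w r₀ J i d * ENNReal.ofReal d + ENNReal.ofReal (1 / 2 + δ) +
          ENNReal.ofReal C * ∑' d, chainLaw w r₀ J i d * (if d < d₀ then 1 else 0) := by
          simp only [mul_add, ENNReal.tsum_add, ENNReal.tsum_mul_right, tsum_chainLaw hw, one_mul,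
            ← ENNReal.tsum_mul_left]
          congr 2
          exact funext fun d => by ring
      _ ≤ ENNReal.ofReal (r₀ + i * (1 / 2 + δ + C * q)) + ENNReal.ofReal (1 / 2 + δ) +
          ENNReal.ofReal C * ENNReal.ofReal q := by
          gcongr
          · exact ih (by omega)
          · exact hsmall i (by omega)
      _ = _ := by
          rw [← ENNReal.ofReal_mul hC.le, ← ENNReal.ofReal_add (by positivity) (by positivity),
            ← ENNReal.ofReal_add (by positivity) (by positivity)]
          congr 1
          push_cast; ring

/-- Foster-Lyapunov bound for the absorption time at `0`. -/
def AbsorbDrift (w : ℤ → ℝ) (K L : ℝ) : Prop :=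
  ∀ d : ℕ, ∑' e : ℕ, roundMass w d e * ENNReal.ofReal (K * e + if e = 0 then 0 else L) +
    (if d = 0 then 0 else 1) ≤ ENNReal.ofReal (K * d + if d = 0 then 0 else L)

lemma exists_absorbDrift (hw : GoodWeight w) {δ : ℝ} (hδ0 : 0 < δ) (hδ : δ < 1 / 2) :
    ∃ L : ℝ, 0 < L ∧ AbsorbDrift w (1 / 2 - δ)⁻¹ L := by
  obtain ⟨C, hC, d₀, -, hm⟩ := exists_mean_le hw hδ0 0
  have hp := hw.1
  have hK : 0 < (1 / 2 - δ)⁻¹ := inv_pos.2 (by linarith)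
  set K := (1 / 2 - δ)⁻¹ with hKdef
  have hKδ : K * (1 / 2 - δ) = 1 := inv_mul_cancel₀ (by linarith)
  obtain ⟨p, hp0, hpd⟩ : ∃ p : ℝ, 0 < p ∧ ∀ d < d₀, p ≤ roundKernel w (d + 1) 0 := by
    rcases Nat.eq_zero_or_pos d₀ with h | h
    · exact ⟨1, one_pos, fun d hd => by omega⟩
    · obtain ⟨m, -, hmin⟩ := Finset.exists_min_image (Finset.range d₀)
        (fun d => roundKernel w (d + 1) 0) ⟨0, Finset.mem_range.2 h⟩
      exact ⟨_, roundKernel_zero_right_pos hp (m + 1), fun d hd => hmin d (Finset.mem_range.2 hd)⟩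
  refine ⟨(K * C + 1) / p, by positivity, fun d => ?_⟩
  set L := (K * C + 1) / p with hL
  have hL0 : 0 < L := by positivity
  have hLp : L * p = K * C + 1 := div_mul_cancel₀ _ hp0.ne'
  have hf0 (e : ℕ) : 0 ≤ K * (e : ℝ) + if e = 0 then 0 else L := by
    split_ifs <;> positivity
  cases d with
  | zero =>
    simp only [roundMass, roundKernel]
    rw [tsum_eq_single 0 fun e he => by simp [he]]
    simp
  | succ d =>
    obtain ⟨hs, hle⟩ := hm d
    have h1 : HasSum (fun e : ℕ => roundKernel w (d + 1) e * if e = 0 then 0 else L)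
        (L * (1 - roundKernel w (d + 1) 0)) := by
      refine (((hasSum_roundKernel hw (d + 1)).sub
        (hasSum_ite_eq 0 (roundKernel w (d + 1) 0))).mul_left L).of_fun_eq fun e => ?_
      split_ifs with h
      · rw [h]; ring
      · ring
    have h2 := ((hs.mul_left K).add h1).of_fun_eq
      (g := fun e : ℕ => roundKernel w (d + 1) e * (K * e + if e = 0 then 0 else L))
      fun e => by ring
    rw [tsum_roundMass_mul hp hf0 h2, if_neg (Nat.succ_ne_zero d), if_neg (Nat.succ_ne_zero d),
      ← ENNReal.ofReal_one, ← ENNReal.ofReal_add (h2.nonneg fun e =>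
        mul_nonneg (roundKernel_nonneg hp _ _) (hf0 e)) zero_le_one]
    apply ENNReal.ofReal_le_ofReal
    have h3 := mul_le_mul_of_nonneg_left hle hK.le
    have h4 := roundKernel_zero_right_pos hp (d + 1)
    push_cast
    split_ifs at h3 with hd
    · have := hpd d hd
      nlinarith
    · nlinarith

lemma sum_chainLaw_pos_le {K L : ℝ} (H : AbsorbDrift w K L) (r₀ J n : ℕ) :
    ∑ i ∈ Finset.range n, ∑' e, chainLaw w r₀ J (J + i) e * (if e = 0 then 0 else 1) ≤
      ∑' e : ℕ, chainLaw w r₀ J J e * ENNReal.ofReal (K * e + if e = 0 then 0 else L) := by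
  suffices ∑' e : ℕ, chainLaw w r₀ J (J + n) e * ENNReal.ofReal (K * e + if e = 0 then 0 else L) +
      ∑ i ∈ Finset.range n, ∑' e, chainLaw w r₀ J (J + i) e * (if e = 0 then 0 else 1) ≤
      ∑' e : ℕ, chainLaw w r₀ J J e * ENNReal.ofReal (K * e + if e = 0 then 0 else L) from
    le_trans le_add_self this
  induction n with
  | zero => simp
  | succ n ih =>
    refine le_trans ?_ ih
    rw [Finset.sum_range_succ, ← add_assoc J, tsum_chainLaw_succ, add_comm (Finset.sum _ _),
      ← add_assoc, ← ENNReal.tsum_add]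
    gcongr with d
    rw [if_neg (by omega : ¬ J + n < J), ← mul_add]
    exact mul_le_mul_right (H d) _

lemma tsum_chainLaw_pos_antitone (hw : GoodWeight w) (r₀ J : ℕ) :
    Antitone fun i => ∑' e, chainLaw w r₀ J (J + i) e * (if e = 0 then 0 else 1) := by
  refine antitone_nat_of_succ_le fun i => ?_
  rw [← add_assoc, tsum_chainLaw_succ]
  refine ENNReal.tsum_le_tsum fun d => mul_le_mul_right ?_ _
  rw [if_neg (by omega), add_zero]
  split_ifs with h
  · subst h
    simp only [roundMass, roundKernel]
    refine le_of_eq (ENNReal.tsum_eq_zero.2 fun e => ?_)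
    by_cases he : e = 0 <;> simp [he]
  · refine le_trans (ENNReal.tsum_le_tsum fun e => ?_) (tsum_roundMass hw d).le
    exact mul_le_of_le_one_right' (by split_ifs <;> simp)

lemma chainLaw_zero_add_pos (hw : GoodWeight w) (r₀ J i : ℕ) :
    chainLaw w r₀ J i 0 + ∑' e, chainLaw w r₀ J i e * (if e = 0 then 0 else 1) = 1 := by
  conv_rhs => rw [← tsum_chainLaw hw r₀ J i]
  have h : chainLaw w r₀ J i 0 = ∑' e, chainLaw w r₀ J i e * (if e = 0 then 1 else 0) := by
    rw [tsum_eq_single 0 fun e he => by simp [he]]; simp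
  rw [h, ← ENNReal.tsum_add]
  exact tsum_congr fun e => by split_ifs <;> simp

end Chain

section Asymptotics

variable {w : ℤ → ℝ}

lemma ExpDrift.mono {δ θ : ℝ} {d₁ d₂ : ℕ} (H : ExpDrift w δ θ d₁) (h : d₁ ≤ d₂) :
    ExpDrift w δ θ d₂ :=
  fun d c hc => H d c (le_trans (by exact_mod_cast h) hc)

lemma tendsto_exp_mul_atTop {θ g : ℝ} {G : ℝ → ℝ} (hθ : 0 < θ) (hg : g < 0)
    (hG : Tendsto (fun A => G A / A) atTop (𝓝 g)) :
    Tendsto (fun A => Real.exp (θ * G A)) atTop (𝓝 0) := by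
  refine Real.tendsto_exp_atBot.comp ?_
  have h1 : Tendsto (fun A : ℝ => G A / A * (θ * A)) atTop atBot :=
    hG.neg_mul_atTop hg (tendsto_id.const_mul_atTop hθ)
  refine h1.congr' ?_
  filter_upwards [eventually_gt_atTop 0] with A hA
  field_simp

lemma tendsto_chainLaw_zero_of_lt (hw : GoodWeight w) {r J n : ℝ → ℕ} {h ξ ν : ℝ} (hξ : 0 ≤ ξ)
    (hν : 0 ≤ ν) (hr : Tendsto (fun A => (r A : ℝ) / A) atTop (𝓝 h))
    (hJ : Tendsto (fun A => (J A : ℝ) / A) atTop (𝓝 ξ))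
    (hn : Tendsto (fun A => (n A : ℝ) / A) atTop (𝓝 ν)) (hh : 0 < h) (hlt : ν < 2 * h + ξ) :
    Tendsto (fun A => chainLaw w (r A) (J A) (J A + n A) 0) atTop (𝓝 0) := by
  obtain ⟨δ, hδ0, hδ, hδlt⟩ : ∃ δ : ℝ, 0 < δ ∧ δ < 1 / 2 ∧
      ν * (1 / 2 + δ) - ξ * (1 / 2 - δ) < h := by
    refine ⟨min (1 / 4) ((h - (ν - ξ) / 2) / 2 / (ν + ξ + 1)), ?_, ?_, ?_⟩
    · exact lt_min (by norm_num) (div_pos (by linarith) (by positivity))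
    · exact (min_le_left _ _).trans_lt (by norm_num)
    · have h1 := min_le_right (1 / 4) ((h - (ν - ξ) / 2) / 2 / (ν + ξ + 1))
      rw [le_div_iff₀ (by positivity)] at h1
      have h2 : 0 < min (1 / 4) ((h - (ν - ξ) / 2) / 2 / (ν + ξ + 1)) :=
        lt_min (by norm_num) (div_pos (by linarith) (by positivity))
      nlinarith
  obtain ⟨θ, hθ, d₁, H⟩ := exists_expDrift hw hδ0
  have hinv : Tendsto (fun A : ℝ => (d₁ : ℝ) / A) atTop (𝓝 0) :=
    tendsto_const_nhds.div_atTop tendsto_id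
  have hG : Tendsto (fun A : ℝ => (max (d₁ + n A * (1 / 2 + δ) - J A * (1 / 2 - δ)) (d₁ : ℝ)
      - r A) / A) atTop (𝓝 (max (0 + ν * (1 / 2 + δ) - ξ * (1 / 2 - δ)) 0 - h)) := by
    refine ((((hinv.add (hn.mul_const _)).sub (hJ.mul_const _)).max hinv).sub hr).congr' ?_
    filter_upwards [eventually_gt_atTop 0] with A hA
    rw [sub_div, ← max_div_div_right hA.le]
    congr 2
    field_simp
  have hexp := tendsto_exp_mul_atTop hθ
    (sub_neg.2 (max_lt (by linarith) hh)) hG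
  have h0 := ENNReal.tendsto_ofReal hexp
  rw [ENNReal.ofReal_zero] at h0
  exact tendsto_of_tendsto_of_tendsto_of_le_of_le tendsto_const_nhds h0
    (fun _ => zero_le) (fun A => chainLaw_zero_le hθ H hδ0 hδ _ _ _)

lemma Antitone.mul_add_mul_le_sum {f : ℕ → ℝ≥0∞} (hf : Antitone f) (m k : ℕ) :
    (m : ℝ≥0∞) * f m + k * f (m + k) ≤ ∑ i ∈ Finset.range (m + k), f i := by
  rw [Finset.sum_range_add]
  gcongr
  · have := Finset.card_nsmul_le_sum (Finset.range m) f (f m)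
      fun i hi => hf (Finset.mem_range.1 hi).le
    simpa using this
  · have := Finset.card_nsmul_le_sum (Finset.range k) (fun i => f (m + i)) (f (m + k))
      fun i hi => hf (by have := Finset.mem_range.1 hi; omega)
    simpa using this

/-- Survival bound obtained from the Foster-Lyapunov estimate. -/
lemma exists_survival_bound (hw : GoodWeight w) {δ : ℝ} (hδ0 : 0 < δ) (hδ : δ < 1 / 2) :
    ∃ θ C L d₀ : ℝ, 0 < θ ∧ 0 < C ∧ ∀ r₀ J m k : ℕ,
      (m : ℝ) * (1 - (chainLaw w r₀ J (J + m) 0).toReal) +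
        k * (1 - (chainLaw w r₀ J (J + (m + k)) 0).toReal) ≤
      (1 / 2 - δ)⁻¹ * (r₀ + J * (1 / 2 + δ + C * Real.exp (θ * (d₀ - r₀)))) + L := by
  obtain ⟨θ, hθ, d₁, H⟩ := exists_expDrift hw hδ0
  obtain ⟨C, hC, d₀, hd, hm⟩ := exists_mean_le hw hδ0 d₁
  obtain ⟨L, hL, HA⟩ := exists_absorbDrift hw hδ0 hδ
  refine ⟨θ, C, L, d₀, hθ, hC, fun r₀ J m k => ?_⟩
  have hK : 0 < (1 / 2 - δ)⁻¹ := inv_pos.2 (by linarith)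
  set K := (1 / 2 - δ)⁻¹
  set f : ℕ → ℝ≥0∞ := fun i => ∑' e, chainLaw w r₀ J (J + i) e * (if e = 0 then 0 else 1) with hf
  have hmean := tsum_chainLaw_mean_le hw hδ0 hC hm (r₀ := r₀) (J := J)
    (q := Real.exp (θ * (d₀ - r₀))) (Real.exp_pos _).le
    (fun i hi => tsum_chainLaw_indicator_le hθ (H.mono hd) hδ r₀ J hi) le_rfl
  have hV : ∑' e : ℕ, chainLaw w r₀ J J e * ENNReal.ofReal (K * e + if e = 0 then 0 else L) ≤
      ENNReal.ofReal (K * (r₀ + J * (1 / 2 + δ + C * Real.exp (θ * (d₀ - r₀)))) + L) := by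
    calc _ ≤ ∑' e : ℕ, chainLaw w r₀ J J e * (ENNReal.ofReal K * ENNReal.ofReal e +
          ENNReal.ofReal L) := by
          refine ENNReal.tsum_le_tsum fun e => mul_le_mul_right ?_ _
          rw [← ENNReal.ofReal_mul hK.le, ← ENNReal.ofReal_add (by positivity) hL.le]
          apply ENNReal.ofReal_le_ofReal
          gcongr
          split_ifs <;> linarith
      _ = ENNReal.ofReal K * ∑' e : ℕ, chainLaw w r₀ J J e * ENNReal.ofReal e +
          ENNReal.ofReal L := by
          simp only [mul_add, ENNReal.tsum_add, ENNReal.tsum_mul_right, tsum_chainLaw hw, one_mul,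
            ← ENNReal.tsum_mul_left]
          congr 2
          exact funext fun d => by ring
      _ ≤ ENNReal.ofReal K * ENNReal.ofReal (r₀ + J * (1 / 2 + δ +
          C * Real.exp (θ * (d₀ - r₀)))) + ENNReal.ofReal L := by gcongr
      _ = _ := by
          rw [← ENNReal.ofReal_mul hK.le, ← ENNReal.ofReal_add (by positivity) hL.le]
  have hmain := ((tsum_chainLaw_pos_antitone hw r₀ J).mul_add_mul_le_sum m k).trans
    ((sum_chainLaw_pos_le HA r₀ J (m + k)).trans hV)
  have hfin (i : ℕ) : f i ≠ ∞ := by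
    have := chainLaw_zero_add_pos hw r₀ J (J + i)
    exact ne_top_of_le_ne_top ENNReal.one_ne_top (this ▸ le_add_self)
  have hzfin (i : ℕ) : chainLaw w r₀ J (J + i) 0 ≠ ∞ := by
    have := chainLaw_zero_add_pos hw r₀ J (J + i)
    exact ne_top_of_le_ne_top ENNReal.one_ne_top (this ▸ le_self_add)
  have hq (i : ℕ) : (f i).toReal = 1 - (chainLaw w r₀ J (J + i) 0).toReal := by
    have := congrArg ENNReal.toReal (chainLaw_zero_add_pos hw r₀ J (J + i))
    rw [ENNReal.toReal_add (hzfin i) (hfin i), ENNReal.toReal_one] at this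
    linarith
  have h := ENNReal.toReal_mono ENNReal.ofReal_ne_top hmain
  rw [ENNReal.toReal_ofReal (by positivity)] at h
  change ((m : ℝ≥0∞) * f m + k * f (m + k)).toReal ≤ _ at h
  rw [ENNReal.toReal_add (ENNReal.mul_ne_top (ENNReal.natCast_ne_top _) (hfin _))
    (ENNReal.mul_ne_top (ENNReal.natCast_ne_top _) (hfin _)), ENNReal.toReal_mul,
    ENNReal.toReal_mul, hq, hq] at h
  simpa using h

lemma tendsto_chainLaw_zero_of_gt (hw : GoodWeight w) {r J n : ℝ → ℕ} {h ξ ν : ℝ} (hξ : 0 ≤ ξ)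
    (hr : Tendsto (fun A => (r A : ℝ) / A) atTop (𝓝 h))
    (hJ : Tendsto (fun A => (J A : ℝ) / A) atTop (𝓝 ξ))
    (hn : Tendsto (fun A => (n A : ℝ) / A) atTop (𝓝 ν)) (hh : 0 < h) (hlt : 2 * h + ξ < ν) :
    Tendsto (fun A => 1 - (chainLaw w (r A) (J A) (J A + n A) 0).toReal) atTop (𝓝 0) := by
  have hle1 (r₀ J i : ℕ) : (chainLaw w r₀ J i 0).toReal ≤ 1 := by
    have := chainLaw_zero_add_pos hw r₀ J i
    exact ENNReal.toReal_mono ENNReal.one_ne_top (this ▸ le_self_add)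
  rw [tendsto_order]
  refine ⟨fun a ha => Eventually.of_forall fun A => by linarith [hle1 (r A) (J A) (J A + n A)],
    fun ε hε => ?_⟩
  obtain ⟨t, ht0, ht, htν, htε⟩ : ∃ t : ℝ, 0 < t ∧ t < 1 / 2 ∧ 0 ≤ 2 * h + ξ - t ∧
      ((1 / 2 - t)⁻¹ * (h + ξ * (1 / 2 + t)) - (2 * h + ξ - t)) / (ν - (2 * h + ξ - t)) < ε := by
    have hc : ContinuousAt (fun t : ℝ => ((1 / 2 - t)⁻¹ * (h + ξ * (1 / 2 + t)) -
        (2 * h + ξ - t)) / (ν - (2 * h + ξ - t))) 0 := by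
      refine ContinuousAt.div ?_ (by fun_prop) (by simp; linarith)
      refine ContinuousAt.sub (ContinuousAt.mul (ContinuousAt.inv₀ (by fun_prop) (by norm_num))
        (by fun_prop)) (by fun_prop)
    have h0 : ((1 / 2 - 0)⁻¹ * (h + ξ * (1 / 2 + 0)) -
        (2 * h + ξ - 0)) / (ν - (2 * h + ξ - 0)) < ε := by
      norm_num
      rw [show 2 * (h + ξ * (1 / 2)) - (2 * h + ξ) = 0 by ring, zero_div]
      exact hε
    have hev := hc.tendsto.eventually_lt_const h0
    have hev2 : ∀ᶠ t : ℝ in 𝓝 0, t < 1 / 2 ∧ t < 2 * h :=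
      (eventually_lt_nhds (by norm_num)).and (eventually_lt_nhds (by linarith))
    obtain ⟨t, ⟨h1, h2, h3⟩, h4⟩ := (((hev.and hev2).filter_mono nhdsWithin_le_nhds).and
      (self_mem_nhdsWithin : Set.Ioi (0 : ℝ) ∈ 𝓝[>] 0)).exists
    exact ⟨t, h4, h2, by linarith, h1⟩
  obtain ⟨θ, C, L, d₀, hθ, hC, hb⟩ := exists_survival_bound hw ht0 ht
  set ν₀ := 2 * h + ξ - t with hν₀
  set m : ℝ → ℕ := fun A => ⌊ν₀ * A⌋₊ with hmdef
  have hm : Tendsto (fun A => (m A : ℝ) / A) atTop (𝓝 ν₀) := tendsto_nat_floor_mul_div_atTop htν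
  have hz := tendsto_chainLaw_zero_of_lt hw hξ htν hr hJ hm hh (by linarith)
  have hz' := (ENNReal.tendsto_toReal ENNReal.zero_ne_top).comp hz
  rw [ENNReal.toReal_zero] at hz'
  have hinv (c : ℝ) : Tendsto (fun A : ℝ => c / A) atTop (𝓝 0) :=
    tendsto_const_nhds.div_atTop tendsto_id
  have hexp := tendsto_exp_mul_atTop (G := fun A => d₀ - r A) (g := 0 - h) hθ (by linarith) (by
    refine ((hinv d₀).sub hr).congr fun A => ?_
    rw [sub_div])
  have hlim : Tendsto (fun A : ℝ => ((1 / 2 - t)⁻¹ * ((r A : ℝ) / A + (J A : ℝ) / A *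
      (1 / 2 + t + C * Real.exp (θ * (d₀ - r A)))) + L / A -
      (m A : ℝ) / A * (1 - (chainLaw w (r A) (J A) (J A + m A) 0).toReal)) /
      ((n A : ℝ) / A - (m A : ℝ) / A)) atTop
      (𝓝 (((1 / 2 - t)⁻¹ * (h + ξ * (1 / 2 + t + C * 0)) + 0 - ν₀ * (1 - 0)) / (ν - ν₀))) := by
    refine Tendsto.div (Tendsto.sub (Tendsto.add (Tendsto.const_mul _ (hr.add (hJ.mul
      ((hexp.const_mul C).const_add (1 / 2 + t))))) (hinv L)) (hm.mul (hz'.const_sub 1)))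
      (hn.sub hm) ?_
    have : 0 < ν - ν₀ := by linarith
    exact this.ne'
  simp only [mul_zero, add_zero, sub_zero, mul_one] at hlim
  have hdiff := (hn.sub hm).eventually_const_lt (show (0 : ℝ) < ν - ν₀ by linarith)
  filter_upwards [hlim.eventually_lt_const htε, hdiff, eventually_gt_atTop 0] with A h1 h2 hA
  refine lt_of_le_of_lt ?_ h1
  rw [le_div_iff₀ h2]
  have h3 : m A ≤ n A := by
    rw [← sub_div] at h2
    have h4 := (div_pos_iff_of_pos_right hA).1 h2
    have : (m A : ℝ) ≤ n A := by linarith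
    exact_mod_cast this
  have h5 := hb (r A) (J A) (m A) (n A - m A)
  rw [Nat.add_sub_cancel' h3, Nat.cast_sub h3] at h5
  have h6 := div_le_div_of_nonneg_right h5 hA.le
  set Q := 1 - (chainLaw w (r A) (J A) (J A + n A) 0).toReal
  set Q₀ := 1 - (chainLaw w (r A) (J A) (J A + m A) 0).toReal
  set X := Real.exp (θ * (d₀ - r A))
  have h7 : ((m A : ℝ) * Q₀ + ((n A : ℝ) - m A) * Q) / A =
      (m A : ℝ) / A * Q₀ + ((n A : ℝ) / A - (m A : ℝ) / A) * Q := by field_simp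
  have h8 : ((1 / 2 - t)⁻¹ * ((r A : ℝ) + J A * (1 / 2 + t + C * X)) + L) / A =
      (1 / 2 - t)⁻¹ * ((r A : ℝ) / A + (J A : ℝ) / A * (1 / 2 + t + C * X)) + L / A := by
    rw [add_div, mul_div_assoc]; congr 2; field_simp
  rw [h7, h8] at h6
  linarith

end Asymptotics

/-! ### Independent coins attached to the local states of the sites -/

/-- A coin for every site `k` and every pair `(u, v)` of numbers of earlier departures from `k`
to the right and to the left. The value `true` stands for a step to the right. -/
abbrev Coins := ℤ × ℕ × ℕ → Bool

/-- Law of a single coin. -/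
def coinLaw (w : ℤ → ℝ) (i : ℤ × ℕ × ℕ) : Measure Bool :=
  min 1 (ENNReal.ofReal (upProb w ((i.2.1 : ℤ) - i.2.2))) • Measure.dirac true +
    (1 - min 1 (ENNReal.ofReal (upProb w ((i.2.1 : ℤ) - i.2.2)))) • Measure.dirac false

instance (w : ℤ → ℝ) (i : ℤ × ℕ × ℕ) : IsProbabilityMeasure (coinLaw w i) := by
  constructor
  simp [coinLaw, add_tsub_cancel_of_le]

/-- Law of the independent family of coins. -/
def coinsLaw (w : ℤ → ℝ) : Measure Coins := Measure.infinitePi (coinLaw w)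

instance (w : ℤ → ℝ) : IsProbabilityMeasure (coinsLaw w) := by
  unfold coinsLaw; infer_instance

/-- The σ-algebra generated by the coins with index in `S`. -/
@[reducible] def coinsOn (S : Set (ℤ × ℕ × ℕ)) : MeasurableSpace Coins :=
  ⨆ i ∈ S, MeasurableSpace.comap (fun c : Coins => c i) inferInstance

lemma measurableSet_coin {S : Set (ℤ × ℕ × ℕ)} {i : ℤ × ℕ × ℕ} (hi : i ∈ S) (b : Bool) :
    MeasurableSet[coinsOn S] {c | c i = b} := by
  have h : MeasurableSpace.comap (fun c : Coins => c i) inferInstance ≤ coinsOn S :=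
    le_iSup₂_of_le i hi le_rfl
  exact h _ ⟨{b}, MeasurableSet.singleton b, rfl⟩

lemma coinsOn_mono {S T : Set (ℤ × ℕ × ℕ)} (h : S ⊆ T) : coinsOn S ≤ coinsOn T :=
  biSup_mono h

lemma coinsOn_le (S : Set (ℤ × ℕ × ℕ)) : coinsOn S ≤ MeasurableSpace.pi :=
  iSup₂_le fun i _ => (measurable_pi_apply i).comap_le

lemma coinsLaw_inter (w : ℤ → ℝ) {S T : Set (ℤ × ℕ × ℕ)} (hST : Disjoint S T) {A B : Set Coins}
    (hA : MeasurableSet[coinsOn S] A) (hB : MeasurableSet[coinsOn T] B) :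
    coinsLaw w (A ∩ B) = coinsLaw w A * coinsLaw w B := by
  have h1 : ProbabilityTheory.iIndepFun (fun i (c : Coins) => c i) (coinsLaw w) :=
    ProbabilityTheory.iIndepFun_infinitePi (P := coinLaw w) (X := fun _ b => b)
      fun _ => measurable_id
  have h2 := ProbabilityTheory.indep_iSup_of_disjoint
    (fun i => (measurable_pi_apply (X := fun _ : ℤ × ℕ × ℕ => Bool) i).comap_le) h1.iIndep hST
  exact (ProbabilityTheory.Indep_iff _ _ _).1 h2 A B hA hB

lemma coinsLaw_coin_true {w : ℤ → ℝ} (hp : ∀ z, 0 < w z) (i : ℤ × ℕ × ℕ) :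
    coinsLaw w {c | c i = true} = ENNReal.ofReal (upProb w ((i.2.1 : ℤ) - i.2.2)) := by
  have h := congrArg (fun m => m {true}) (Measure.infinitePi_map_eval (coinLaw w) i)
  beta_reduce at h
  rw [Measure.map_apply (measurable_pi_apply i) (MeasurableSet.singleton _)] at h
  have h1 : upProb w ((i.2.1 : ℤ) - i.2.2) ≤ 1 := by
    linarith [upProb_add_downProb hp ((i.2.1 : ℤ) - i.2.2), downProb_pos hp ((i.2.1 : ℤ) - i.2.2)]
  rw [show {c : Coins | c i = true} = (fun c : Coins => c i) ⁻¹' {true} from rfl, coinsLaw, h]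
  simp [coinLaw, h1]

lemma coinsLaw_coin_false {w : ℤ → ℝ} (hp : ∀ z, 0 < w z) (i : ℤ × ℕ × ℕ) :
    coinsLaw w {c | c i = false} = ENNReal.ofReal (downProb w ((i.2.1 : ℤ) - i.2.2)) := by
  have h : {c : Coins | c i = false} = {c | c i = true}ᶜ := by ext c; simp
  rw [h, prob_compl_eq_one_sub (coinsOn_le _ _ (measurableSet_coin (Set.mem_univ i) true)),
    coinsLaw_coin_true hp, ← ENNReal.ofReal_one,
    ← ENNReal.ofReal_sub _ (upProb_pos hp _).le]
  congr 1
  linarith [upProb_add_downProb hp ((i.2.1 : ℤ) - i.2.2)]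

/-- Numbers of steps to the right and to the left among the first `m` departures from `k`. -/
def siteState (c : Coins) (k : ℤ) : ℕ → ℕ × ℕ
  | 0 => (0, 0)
  | m + 1 => if c (k, siteState c k m) then ((siteState c k m).1 + 1, (siteState c k m).2)
      else ((siteState c k m).1, (siteState c k m).2 + 1)

lemma siteState_add (c : Coins) (k : ℤ) (m : ℕ) :
    (siteState c k m).1 + (siteState c k m).2 = m := by
  induction m with
  | zero => rfl
  | succ m ih => simp only [siteState]; split_ifs <;> simp only <;> omega

lemma siteState_fst_mono (c : Coins) (k : ℤ) : Monotone fun m => (siteState c k m).1 :=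
  monotone_nat_of_le_succ fun m => by simp only [siteState]; split_ifs <;> simp

lemma siteState_snd_mono (c : Coins) (k : ℤ) : Monotone fun m => (siteState c k m).2 :=
  monotone_nat_of_le_succ fun m => by simp only [siteState]; split_ifs <;> simp

/-- Coins at site `k` read before the local state reaches level `m`. -/
def coinsBefore (k : ℤ) (m : ℕ) : Set (ℤ × ℕ × ℕ) := {i | i.1 = k ∧ i.2.1 + i.2.2 < m}

lemma siteState_succ_eq (c : Coins) (k : ℤ) (m : ℕ) (q : ℕ × ℕ) :
    siteState c k (m + 1) = q ↔
      (siteState c k m = (q.1 - 1, q.2) ∧ 0 < q.1 ∧ c (k, q.1 - 1, q.2) = true) ∨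
      (siteState c k m = (q.1, q.2 - 1) ∧ 0 < q.2 ∧ c (k, q.1, q.2 - 1) = false) := by
  obtain ⟨u, v⟩ := q
  simp only [siteState]
  rcases hs : siteState c k m with ⟨a, b⟩
  simp only
  split_ifs with h
  · simp only [Prod.mk.injEq]
    constructor
    · rintro ⟨rfl, rfl⟩
      simp [h]
    · rintro (⟨⟨h1, h2⟩, h3, -⟩ | ⟨⟨h1, h2⟩, h3, h4⟩)
      · omega
      · rw [← h1, ← h2] at h4; simp [h4] at h
  · simp only [Prod.mk.injEq]
    constructor
    · rintro ⟨rfl, rfl⟩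
      simp [h]
    · rintro (⟨⟨h1, h2⟩, h3, h4⟩ | ⟨⟨h1, h2⟩, h3, h4⟩)
      · rw [← h1, ← h2] at h4; simp [h4] at h
      · omega

lemma measurableSet_siteState (k : ℤ) (m : ℕ) (q : ℕ × ℕ) :
    MeasurableSet[coinsOn (coinsBefore k m)] {c | siteState c k m = q} := by
  induction m generalizing q with
  | zero => simp [siteState]
  | succ m ih =>
    have hmono := coinsOn_mono (S := coinsBefore k m) (T := coinsBefore k (m + 1))
      fun i hi => ⟨hi.1, hi.2.trans (Nat.lt_succ_self m)⟩
    by_cases hq : q.1 + q.2 = m + 1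
    · have h1 : MeasurableSet[coinsOn (coinsBefore k (m + 1))] {c : Coins |
          siteState c k m = (q.1 - 1, q.2) ∧ 0 < q.1 ∧ c (k, q.1 - 1, q.2) = true} := by
        by_cases h0 : 0 < q.1
        · have hi : (k, q.1 - 1, q.2) ∈ coinsBefore k (m + 1) :=
            ⟨Eq.refl k, show q.1 - 1 + q.2 < m + 1 by omega⟩
          simp only [h0, true_and]
          exact MeasurableSet.inter (hmono _ (ih _)) (measurableSet_coin hi true)
        · simp only [h0, false_and, and_false, Set.ofPred_false]
          exact @MeasurableSet.empty _ (coinsOn (coinsBefore k (m + 1)))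
      have h2 : MeasurableSet[coinsOn (coinsBefore k (m + 1))] {c : Coins |
          siteState c k m = (q.1, q.2 - 1) ∧ 0 < q.2 ∧ c (k, q.1, q.2 - 1) = false} := by
        by_cases h0 : 0 < q.2
        · have hi : (k, q.1, q.2 - 1) ∈ coinsBefore k (m + 1) :=
            ⟨Eq.refl k, show q.1 + (q.2 - 1) < m + 1 by omega⟩
          simp only [h0, true_and]
          exact MeasurableSet.inter (hmono _ (ih _)) (measurableSet_coin hi false)
        · simp only [h0, false_and, and_false, Set.ofPred_false]
          exact @MeasurableSet.empty _ (coinsOn (coinsBefore k (m + 1)))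
      simp only [siteState_succ_eq]
      exact MeasurableSet.union h1 h2
    · have : {c : Coins | siteState c k (m + 1) = q} = ∅ := by
        refine Set.eq_empty_of_forall_notMem fun c hc => hq ?_
        have h := siteState_add c k (m + 1)
        rwa [show siteState c k (m + 1) = q from hc] at h
      rw [this]
      exact @MeasurableSet.empty _ (coinsOn (coinsBefore k (m + 1)))

lemma coinsLaw_siteState_inter_coin (w : ℤ → ℝ) (k : ℤ) (u v : ℕ) (b : Bool) :
    coinsLaw w ({c | siteState c k (u + v) = (u, v)} ∩ {c | c (k, u, v) = b}) =
      coinsLaw w {c | siteState c k (u + v) = (u, v)} * coinsLaw w {c | c (k, u, v) = b} := by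
  refine coinsLaw_inter w (S := coinsBefore k (u + v)) (T := {(k, u, v)}) ?_
    (measurableSet_siteState k _ _) (measurableSet_coin (Set.mem_singleton (k, u, v)) b)
  rw [Set.disjoint_singleton_right]
  exact fun h => lt_irrefl _ h.2

lemma coinsLaw_siteState {w : ℤ → ℝ} (hp : ∀ z, 0 < w z) (k : ℤ) (u v : ℕ) :
    coinsLaw w {c | siteState c k (u + v) = (u, v)} = ENNReal.ofReal (passProb w u v) := by
  suffices ∀ m u v : ℕ, u + v = m →
      coinsLaw w {c | siteState c k (u + v) = (u, v)} = ENNReal.ofReal (passProb w u v) from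
    this _ u v rfl
  intro m
  induction m with
  | zero =>
    intro u v h
    obtain ⟨rfl, rfl⟩ : u = 0 ∧ v = 0 := by omega
    simp [siteState, passProb]
  | succ m ih =>
    intro u v h
    match u, v with
    | 0, 0 => omega
    | u + 1, 0 =>
      have hset : {c : Coins | siteState c k (u + 1 + 0) = (u + 1, 0)} =
          {c | siteState c k (u + 0) = (u, 0)} ∩ {c | c (k, u, 0) = true} := by
        ext c
        simp [siteState_succ_eq]
      rw [hset, coinsLaw_siteState_inter_coin, ih _ _ (by omega), coinsLaw_coin_true hp,
        ← ENNReal.ofReal_mul (passProb_pos hp _ _).le]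
      simp [passProb]
    | 0, v + 1 =>
      have hset : {c : Coins | siteState c k (0 + (v + 1)) = (0, v + 1)} =
          {c | siteState c k (0 + v) = (0, v)} ∩ {c | c (k, 0, v) = false} := by
        ext c
        rw [Set.mem_ofPred_eq, ← add_assoc, siteState_succ_eq]
        simp
      rw [hset, coinsLaw_siteState_inter_coin, ih _ _ (by omega), coinsLaw_coin_false hp,
        ← ENNReal.ofReal_mul (passProb_pos hp _ _).le]
      simp [passProb]
    | u + 1, v + 1 =>
      have hset : {c : Coins | siteState c k (u + 1 + (v + 1)) = (u + 1, v + 1)} =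
          ({c | siteState c k (u + (v + 1)) = (u, v + 1)} ∩ {c | c (k, u, v + 1) = true}) ∪
          ({c | siteState c k (u + 1 + v) = (u + 1, v)} ∩ {c | c (k, u + 1, v) = false}) := by
        ext c
        rw [Set.mem_ofPred_eq, ← add_assoc, siteState_succ_eq]
        simp [show u + 1 + v = u + (v + 1) by omega]
      have hm : MeasurableSet ({c : Coins | siteState c k (u + 1 + v) = (u + 1, v)} ∩
          {c | c (k, u + 1, v) = false}) :=
        (coinsOn_le _ _ (measurableSet_siteState k _ _)).inter
          (coinsOn_le _ _ (measurableSet_coin (Set.mem_univ _) false))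
      rw [hset, measure_union _ hm, coinsLaw_siteState_inter_coin, coinsLaw_siteState_inter_coin,
        ih _ _ (by omega), ih _ _ (by omega), coinsLaw_coin_true hp, coinsLaw_coin_false hp,
        ← ENNReal.ofReal_mul (passProb_pos hp _ _).le,
        ← ENNReal.ofReal_mul (passProb_pos hp _ _).le, ← ENNReal.ofReal_add
          (mul_pos (passProb_pos hp _ _) (upProb_pos hp _)).le
          (mul_pos (passProb_pos hp _ _) (downProb_pos hp _)).le]
      · simp [passProb]
      · rw [Set.disjoint_left]
        rintro c ⟨h1, -⟩ ⟨h2, -⟩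
        simp only [Set.mem_ofPred_eq] at h1 h2
        rw [show u + 1 + v = u + (v + 1) by omega, h1] at h2
        simp at h2

/-- At site `k`, exactly `e` steps to the right precede the `d`-th step to the left. -/
def HitLeft (k : ℤ) : ℕ → ℕ → Coins → Prop
  | 0, e, _ => e = 0
  | d + 1, e, c => siteState c k (e + d) = (e, d) ∧ c (k, e, d) = false

/-- At site `k`, exactly `e` steps to the left precede the `d`-th step to the right. -/
def HitRight (k : ℤ) : ℕ → ℕ → Coins → Prop
  | 0, e, _ => e = 0
  | d + 1, e, c => siteState c k (d + e) = (d, e) ∧ c (k, d, e) = true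

/-- All coins at site `k`. -/
def coinsAt (k : ℤ) : Set (ℤ × ℕ × ℕ) := {i | i.1 = k}

/-- A family of functional relations read off from the coins at `k`, with transition probabilities
given by the round kernel. -/
structure IsRound (w : ℤ → ℝ) (k : ℤ) (H : ℕ → ℕ → Coins → Prop) : Prop where
  meas : ∀ d e, MeasurableSet[coinsOn (coinsAt k)] {c | H d e c}
  prob : ∀ d e, coinsLaw w {c | H d e c} = roundMass w d e
  unique : ∀ d e e' c, H d e c → H d e' c → e = e'

lemma isRound_hitLeft {w : ℤ → ℝ} (hp : ∀ z, 0 < w z) (k : ℤ) : IsRound w k (HitLeft k) where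
  meas d e := by
    cases d with
    | zero => simp [HitLeft]
    | succ d =>
      have hsub : coinsBefore k (e + d) ⊆ coinsAt k := fun i hi => hi.1
      have hi : (k, e, d) ∈ coinsAt k := Eq.refl k
      exact MeasurableSet.inter (coinsOn_mono hsub _ (measurableSet_siteState k (e + d) (e, d)))
        (measurableSet_coin hi false)
  prob d e := by
    cases d with
    | zero =>
      simp only [HitLeft, roundMass, roundKernel]
      split_ifs with h <;> simp [h]
    | succ d =>
      refine (coinsLaw_siteState_inter_coin w k e d false).trans ?_
      rw [coinsLaw_siteState hp, coinsLaw_coin_false hp,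
        ← ENNReal.ofReal_mul (passProb_pos hp _ _).le]
      rfl
  unique d := by
    cases d with
    | zero => intro e e' c h h'; exact h.trans h'.symm
    | succ d =>
      suffices ∀ e e' c, HitLeft k (d + 1) e c → HitLeft k (d + 1) e' c → ¬ e < e' from
        fun e e' c h h' => le_antisymm (not_lt.1 (this _ _ _ h' h)) (not_lt.1 (this _ _ _ h h'))
      rintro e e' c ⟨h1, h2⟩ ⟨h1', -⟩ hlt
      have h3 : siteState c k (e + d + 1) = (e, d + 1) := by simp [siteState, h1, h2]
      have h4 := siteState_snd_mono c k (show e + d + 1 ≤ e' + d by omega)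
      simp only [h3, h1'] at h4
      omega

lemma isRound_hitRight {w : ℤ → ℝ} (hp : ∀ z, 0 < w z) (k : ℤ) : IsRound w k (HitRight k) where
  meas d e := by
    cases d with
    | zero => simp [HitRight]
    | succ d =>
      have hsub : coinsBefore k (d + e) ⊆ coinsAt k := fun i hi => hi.1
      have hi : (k, d, e) ∈ coinsAt k := Eq.refl k
      exact MeasurableSet.inter (coinsOn_mono hsub _ (measurableSet_siteState k (d + e) (d, e)))
        (measurableSet_coin hi true)
  prob d e := by
    cases d with
    | zero =>
      simp only [HitRight, roundMass, roundKernel]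
      split_ifs with h <;> simp [h]
    | succ d =>
      refine (coinsLaw_siteState_inter_coin w k d e true).trans ?_
      rw [coinsLaw_siteState hp, coinsLaw_coin_true hp,
        ← ENNReal.ofReal_mul (passProb_pos hp _ _).le, passProb_comm, roundMass, roundKernel,
        ← downProb_neg, neg_sub]
  unique d := by
    cases d with
    | zero => intro e e' c h h'; exact h.trans h'.symm
    | succ d =>
      suffices ∀ e e' c, HitRight k (d + 1) e c → HitRight k (d + 1) e' c → ¬ e < e' from
        fun e e' c h h' => le_antisymm (not_lt.1 (this _ _ _ h' h)) (not_lt.1 (this _ _ _ h h'))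
      rintro e e' c ⟨h1, h2⟩ ⟨h1', -⟩ hlt
      have h3 : siteState c k (d + e + 1) = (d + 1, e) := by simp [siteState, h1, h2]
      have h4 := siteState_fst_mono c k (show d + e + 1 ≤ d + e' by omega)
      simp only [h3, h1'] at h4
      omega

/-- The chain driven by the relations `H`, started at `r₀`, is at `e` after `i` rounds. -/
def ChainAt (H : ℕ → ℕ → ℕ → Coins → Prop) (r₀ J : ℕ) : ℕ → ℕ → Set Coins
  | 0, e => {_c | e = r₀}
  | i + 1, e => ⋃ d, ChainAt H r₀ J i d ∩ {c | H i (d + if i < J then 1 else 0) e c}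

section ChainAt

variable {w : ℤ → ℝ} {k : ℕ → ℤ} {H : ℕ → ℕ → ℕ → Coins → Prop}

lemma chainAt_unique (hH : ∀ i, IsRound w (k i) (H i)) (r₀ J i : ℕ) {e e' : ℕ} {c : Coins}
    (h : c ∈ ChainAt H r₀ J i e) (h' : c ∈ ChainAt H r₀ J i e') : e = e' := by
  induction i generalizing e e' with
  | zero => exact Eq.trans h (Eq.symm h')
  | succ i ih =>
    obtain ⟨d, hd, hde⟩ := Set.mem_iUnion.1 h
    obtain ⟨d', hd', hde'⟩ := Set.mem_iUnion.1 h'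
    obtain rfl := ih hd hd'
    exact (hH i).unique _ _ _ _ hde hde'

lemma measurableSet_chainAt (hH : ∀ i, IsRound w (k i) (H i)) (r₀ J i e : ℕ) :
    MeasurableSet[coinsOn {x | ∃ i' < i, x.1 = k i'}] (ChainAt H r₀ J i e) := by
  induction i generalizing e with
  | zero => simp [ChainAt]
  | succ i ih =>
    have hsub : {x : ℤ × ℕ × ℕ | ∃ i' < i, x.1 = k i'} ⊆ {x | ∃ i' < i + 1, x.1 = k i'} :=
      fun x ⟨i', hi', h⟩ => ⟨i', by omega, h⟩
    have hsub' : coinsAt (k i) ⊆ {x | ∃ i' < i + 1, x.1 = k i'} :=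
      fun x hx => ⟨i, by omega, hx⟩
    exact MeasurableSet.iUnion fun d => MeasurableSet.inter (coinsOn_mono hsub _ (ih d))
      (coinsOn_mono hsub' _ ((hH i).meas _ _))

lemma coinsLaw_chainAt (hk : Function.Injective k) (hH : ∀ i, IsRound w (k i) (H i))
    (r₀ J i e : ℕ) : coinsLaw w (ChainAt H r₀ J i e) = chainLaw w r₀ J i e := by
  induction i generalizing e with
  | zero =>
    simp only [ChainAt, chainLaw]
    split_ifs with h <;> simp [h]
  | succ i ih =>
    simp only [ChainAt, chainLaw]
    rw [measure_iUnion]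
    · refine tsum_congr fun d => ?_
      rw [coinsLaw_inter w ?_ (measurableSet_chainAt hH r₀ J i d) ((hH i).meas _ _), ih,
        (hH i).prob]
      rw [Set.disjoint_left]
      rintro x ⟨i', hi', h⟩ hx
      have : i' = i := hk (h.symm.trans hx)
      omega
    · intro d d' hdd'
      rw [Function.onFun, Set.disjoint_left]
      rintro c ⟨h, -⟩ ⟨h', -⟩
      exact hdd' (chainAt_unique hH r₀ J i h h')
    · exact fun d => (coinsOn_le _ _ (measurableSet_chainAt hH r₀ J i d)).inter
        (coinsOn_le _ _ ((hH i).meas _ _))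

end ChainAt

/-! ### The walk driven by the coins -/

lemma dirLocP_succ (x : ℕ → ℤ) (n : ℕ) (k : ℤ) :
    dirLocP x (n + 1) k = dirLocP x n k + if x n = k ∧ x (n + 1) = k + 1 then 1 else 0 := by
  simp only [dirLocP, Finset.range_add_one, Finset.filter_insert]
  split_ifs <;> simp

lemma dirLocM_succ (x : ℕ → ℤ) (n : ℕ) (k : ℤ) :
    dirLocM x (n + 1) k = dirLocM x n k + if x n = k ∧ x (n + 1) = k - 1 then 1 else 0 := by
  simp only [dirLocM, Finset.range_add_one, Finset.filter_insert]
  split_ifs <;> simp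

lemma dirLocP_mono (x : ℕ → ℤ) (k : ℤ) : Monotone fun n => dirLocP x n k :=
  monotone_nat_of_le_succ fun n => by simp [dirLocP_succ]

lemma dirLocM_mono (x : ℕ → ℤ) (k : ℤ) : Monotone fun n => dirLocM x n k :=
  monotone_nat_of_le_succ fun n => by simp [dirLocM_succ]

lemma dirLocP_congr {x y : ℕ → ℤ} {n : ℕ} (h : ∀ i ≤ n, x i = y i) (k : ℤ) :
    dirLocP x n k = dirLocP y n k := by
  induction n with
  | zero => simp [dirLocP]
  | succ n ih =>
    rw [dirLocP_succ, dirLocP_succ, ih fun i hi => h i (by omega), h n (by omega),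
      h (n + 1) le_rfl]

lemma dirLocM_congr {x y : ℕ → ℤ} {n : ℕ} (h : ∀ i ≤ n, x i = y i) (k : ℤ) :
    dirLocM x n k = dirLocM y n k := by
  induction n with
  | zero => simp [dirLocM]
  | succ n ih =>
    rw [dirLocM_succ, dirLocM_succ, ih fun i hi => h i (by omega), h n (by omega),
      h (n + 1) le_rfl]

/-- Position of the walk driven by the coins, and number of earlier departures from each site. -/
def walkState (c : Coins) : ℕ → ℤ × (ℤ → ℕ)
  | 0 => (0, fun _ => 0)
  | n + 1 =>
    ((walkState c n).1 + if c ((walkState c n).1,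
        siteState c (walkState c n).1 ((walkState c n).2 (walkState c n).1)) then 1 else -1,
      Function.update (walkState c n).2 (walkState c n).1
        ((walkState c n).2 (walkState c n).1 + 1))

/-- The walk driven by the coins. -/
def coinWalk (c : Coins) (n : ℕ) : ℤ := (walkState c n).1

lemma siteState_walkState (c : Coins) (n : ℕ) (k : ℤ) :
    siteState c k ((walkState c n).2 k) = (dirLocP (coinWalk c) n k, dirLocM (coinWalk c) n k) := by
  induction n with
  | zero => simp [walkState, siteState, dirLocP, dirLocM]
  | succ n ih =>
    rw [dirLocP_succ, dirLocM_succ]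
    by_cases hk : coinWalk c n = k
    · have h1 : (walkState c (n + 1)).2 k = (walkState c n).2 k + 1 := by
        subst hk
        simp [walkState, coinWalk]
      have h2 : coinWalk c (n + 1) =
          k + if c (k, siteState c k ((walkState c n).2 k)) then 1 else -1 := by
        subst hk
        rfl
      rw [h1, siteState, ih, h2, ih]
      split_ifs <;> simp_all <;> omega
    · have h1 : (walkState c (n + 1)).2 k = (walkState c n).2 k := by
        simp only [walkState]
        exact Function.update_of_ne (fun h => hk h.symm) _ _
      rw [h1, ih]
      simp [hk]

lemma siteState_dirLoc (c : Coins) (n : ℕ) (k : ℤ) :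
    siteState c k (dirLocP (coinWalk c) n k + dirLocM (coinWalk c) n k) =
      (dirLocP (coinWalk c) n k, dirLocM (coinWalk c) n k) := by
  have h := siteState_add c k ((walkState c n).2 k)
  rw [siteState_walkState] at h
  simp only at h
  rw [h, siteState_walkState]

lemma coinWalk_succ (c : Coins) (n : ℕ) :
    coinWalk c (n + 1) = coinWalk c n + if c (coinWalk c n, dirLocP (coinWalk c) n (coinWalk c n),
      dirLocM (coinWalk c) n (coinWalk c n)) then 1 else -1 := by
  rw [← siteState_walkState]
  rfl

/-- The coin read by a walk with path `x` at time `n`. -/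
def coinIndex (x : ℕ → ℤ) (n : ℕ) : ℤ × ℕ × ℕ := (x n, dirLocP x n (x n), dirLocM x n (x n))

lemma coinIndex_injOn {x : ℕ → ℤ} {n i : ℕ} (hi : i < n)
    (hx : x (i + 1) = x i + 1 ∨ x (i + 1) = x i - 1) : coinIndex x n ≠ coinIndex x i := by
  intro h
  simp only [coinIndex, Prod.mk.injEq] at h
  obtain ⟨h0, h1, h2⟩ := h
  rw [h0] at h1 h2
  have hP := dirLocP_mono x (x i) hi
  have hM := dirLocM_mono x (x i) hi
  simp only [Nat.succ_eq_add_one, dirLocP_succ, dirLocM_succ] at hP hM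
  rcases hx with hx | hx <;> simp [hx] at hP hM <;> omega

lemma coinWalk_eq_iff (x : ℕ → ℤ) (n : ℕ) (c : Coins) :
    (∀ i ≤ n + 1, coinWalk c i = x i) ↔ (∀ i ≤ n, coinWalk c i = x i) ∧
      x (n + 1) = x n + if c (coinIndex x n) then 1 else -1 := by
  have key : (∀ i ≤ n, coinWalk c i = x i) →
      coinWalk c (n + 1) = x n + if c (coinIndex x n) then 1 else -1 := by
    intro h
    rw [coinWalk_succ, dirLocP_congr h, dirLocM_congr h, h n le_rfl, coinIndex]
  constructor
  · intro h
    have h' : ∀ i ≤ n, coinWalk c i = x i := fun i hi => h i (by omega)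
    exact ⟨h', by rw [← key h', h _ le_rfl]⟩
  · rintro ⟨h, h'⟩ i hi
    rcases Nat.le_succ_iff.1 hi with hi | rfl
    · exact h i hi
    · rw [key h, h']

lemma measurableSet_coinWalk_eq (x : ℕ → ℤ) (n : ℕ) :
    MeasurableSet[coinsOn {a | ∃ i < n, a = coinIndex x i}]
      {c | ∀ i ≤ n, coinWalk c i = x i} := by
  induction n with
  | zero => simp [coinWalk, walkState]
  | succ n ih =>
    have hsub : {a | ∃ i < n, a = coinIndex x i} ⊆ {a | ∃ i < n + 1, a = coinIndex x i} :=
      fun a ⟨i, hi, h⟩ => ⟨i, by omega, h⟩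
    have hmem : coinIndex x n ∈ {a | ∃ i < n + 1, a = coinIndex x i} := ⟨n, by omega, rfl⟩
    have hset : {c : Coins | ∀ i ≤ n + 1, coinWalk c i = x i} =
        {c | ∀ i ≤ n, coinWalk c i = x i} ∩ ((fun c : Coins => c (coinIndex x n)) ⁻¹'
          {b | x (n + 1) = x n + if b then 1 else -1}) := by
      ext c
      exact coinWalk_eq_iff x n c
    rw [hset]
    have hle : MeasurableSpace.comap (fun c : Coins => c (coinIndex x n)) inferInstance ≤
      coinsOn {a | ∃ i < n + 1, a = coinIndex x i} := le_iSup₂_of_le _ hmem le_rfl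
    exact MeasurableSet.inter (coinsOn_mono hsub _ ih) (hle _ ⟨_, MeasurableSet.of_discrete, rfl⟩)

lemma coinsLaw_step {w : ℤ → ℝ} (hp : ∀ z, 0 < w z) (x : ℕ → ℤ) (n : ℕ) :
    coinsLaw w {c | x (n + 1) = x n + if c (coinIndex x n) then 1 else -1} =
      ENNReal.ofReal (stepProb w x n) := by
  simp only [stepProb]
  split_ifs with h1 h2
  · rw [show {c : Coins | x (n + 1) = x n + if c (coinIndex x n) then 1 else -1} =
      {c | c (coinIndex x n) = true} by ext c; by_cases h : c (coinIndex x n) <;> simp [h1, h],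
      coinsLaw_coin_true hp]
    rfl
  · rw [show {c : Coins | x (n + 1) = x n + if c (coinIndex x n) then 1 else -1} =
      {c | c (coinIndex x n) = false} by
        ext c
        by_cases h : c (coinIndex x n) <;> simp [h2, h, sub_eq_add_neg],
      coinsLaw_coin_false hp]
    rfl
  · rw [show {c : Coins | x (n + 1) = x n + if c (coinIndex x n) then 1 else -1} = ∅ by
      ext c
      by_cases h : c (coinIndex x n) <;> simp [h, h1]
      simpa [sub_eq_add_neg] using h2]
    simp

lemma coinsLaw_coinWalk_eq {w : ℤ → ℝ} (hp : ∀ z, 0 < w z) (n : ℕ) (x : ℕ → ℤ) :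
    coinsLaw w {c | ∀ i ≤ n + 1, coinWalk c i = x i} =
      coinsLaw w {c | ∀ i ≤ n, coinWalk c i = x i} * ENNReal.ofReal (stepProb w x n) := by
  by_cases hx : ∀ i < n, x (i + 1) = x i + 1 ∨ x (i + 1) = x i - 1
  · rw [← coinsLaw_step hp, ← coinsLaw_inter w (S := {a | ∃ i < n, a = coinIndex x i})
      (T := {coinIndex x n}) _ (measurableSet_coinWalk_eq x n) _]
    · congr 1
      ext c
      exact coinWalk_eq_iff x n c
    · rw [Set.disjoint_singleton_right]
      rintro ⟨i, hi, h⟩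
      exact coinIndex_injOn hi (hx i hi) h
    · have hle : MeasurableSpace.comap (fun c : Coins => c (coinIndex x n)) inferInstance ≤
        coinsOn {coinIndex x n} := le_iSup₂_of_le _ (Set.mem_singleton _) le_rfl
      exact hle _ ⟨{b | x (n + 1) = x n + if b then 1 else -1}, MeasurableSet.of_discrete, rfl⟩
  · push Not at hx
    obtain ⟨i, hi, h1, h2⟩ := hx
    have hempty : {c : Coins | ∀ i ≤ n, coinWalk c i = x i} = ∅ := by
      refine Set.eq_empty_of_forall_notMem fun c hc => ?_
      have h := coinWalk_succ c i
      rw [hc i hi.le, hc (i + 1) hi] at h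
      split_ifs at h
      · exact h1 h
      · exact h2 h
    have hempty' : {c : Coins | ∀ i ≤ n + 1, coinWalk c i = x i} = ∅ :=
      Set.subset_eq_empty (fun c hc i hi => hc i (Nat.le_succ_of_le hi)) hempty
    rw [hempty, hempty']
    simp

lemma measurable_coinWalk (n : ℕ) : Measurable fun c : Coins => coinWalk c n := by
  refine measurable_to_countable' fun z => ?_
  have hset : (fun c : Coins => coinWalk c n) ⁻¹' {z} =
      ⋃ v : Fin (n + 1) → ℤ, {c | ∀ i ≤ n, coinWalk c i = v (Fin.ofNat (n + 1) i)} ∩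
        {_c | v (Fin.last n) = z} := by
    ext c
    simp only [Set.mem_preimage, Set.mem_singleton_iff, Set.mem_iUnion, Set.mem_inter_iff,
      Set.mem_ofPred_eq]
    constructor
    · intro h
      refine ⟨fun i => coinWalk c i, fun i hi => ?_, h⟩
      simp [Nat.mod_eq_of_lt (Nat.lt_succ_of_le hi)]
    · rintro ⟨v, h1, h2⟩
      rw [h1 n le_rfl, ← h2]
      congr 1
      ext
      simp
  rw [hset]
  exact MeasurableSet.iUnion fun v =>
    (coinsOn_le _ _ (measurableSet_coinWalk_eq (fun i => v (Fin.ofNat (n + 1) i)) n)).inter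
      (MeasurableSet.const _)

lemma isSRW_coinWalk {w : ℤ → ℝ} (hp : ∀ z, 0 < w z) :
    IsSRW (coinsLaw w) w fun n c => coinWalk c n :=
  ⟨measurable_coinWalk, by simp [coinWalk, walkState], coinsLaw_coinWalk_eq hp⟩

/-! ### Uniqueness in law -/

section Transfer

variable {Ω Ω' : Type*} [MeasurableSpace Ω] [MeasurableSpace Ω'] {μ : Measure Ω} {ν : Measure Ω'}
  [IsProbabilityMeasure μ] [IsProbabilityMeasure ν] {w : ℤ → ℝ} {X : ℕ → Ω → ℤ} {Y : ℕ → Ω' → ℤ}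

lemma IsSRW.cylinder_zero (hX : IsSRW μ w X) (x : ℕ → ℤ) :
    μ {ω | ∀ i ≤ 0, X i ω = x i} = if x 0 = 0 then 1 else 0 := by
  have hm : MeasurableSet {ω | X 0 ω = 0} := hX.1 0 (MeasurableSet.singleton 0)
  simp only [Nat.le_zero, forall_eq]
  split_ifs with h
  · rw [h, hX.2.1]
  · have hsub : {ω | X 0 ω = x 0} ⊆ {ω | X 0 ω = 0}ᶜ :=
      fun ω hω hω' => h ((Eq.symm hω).trans hω')
    exact measure_mono_null hsub ((prob_compl_eq_zero_iff hm).2 hX.2.1)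

lemma IsSRW.cylinder_eq (hX : IsSRW μ w X) (hY : IsSRW ν w Y) (n : ℕ) (x : ℕ → ℤ) :
    μ {ω | ∀ i ≤ n, X i ω = x i} = ν {ω | ∀ i ≤ n, Y i ω = x i} := by
  induction n with
  | zero => rw [hX.cylinder_zero, hY.cylinder_zero]
  | succ n ih => rw [hX.2.2, hY.2.2, ih]

/-- The first `n + 1` positions of the path. -/
def initialPath {α : Type*} (X : ℕ → α → ℤ) (n : ℕ) (ω : α) : Fin (n + 1) → ℤ := fun i => X i ω

lemma measurable_initialPath (hX : ∀ n, Measurable (X n)) (n : ℕ) :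
    Measurable (initialPath X n) := measurable_pi_lambda _ fun i => hX i

lemma initialPath_preimage_singleton {α : Type*} (X : ℕ → α → ℤ) (n : ℕ) (v : Fin (n + 1) → ℤ) :
    initialPath X n ⁻¹' {v} = {ω | ∀ i ≤ n, X i ω = v (Fin.ofNat (n + 1) i)} := by
  ext ω
  simp only [Set.mem_preimage, Set.mem_singleton_iff, Set.mem_ofPred_eq, funext_iff, initialPath]
  constructor
  · intro h i hi
    rw [← h]
    simp [Nat.mod_eq_of_lt (Nat.lt_succ_of_le hi)]
  · intro h i
    rw [h i (by omega)]
    congr 1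
    ext
    simp

lemma IsSRW.map_initialPath_eq (hX : IsSRW μ w X) (hY : IsSRW ν w Y) (n : ℕ) :
    μ.map (initialPath X n) = ν.map (initialPath Y n) := by
  refine Measure.ext_of_singleton fun v => ?_
  rw [Measure.map_apply (measurable_initialPath hX.1 n) (MeasurableSet.singleton v),
    Measure.map_apply (measurable_initialPath hY.1 n) (MeasurableSet.singleton v),
    initialPath_preimage_singleton, initialPath_preimage_singleton, hX.cylinder_eq hY]

/-- A property of paths which, when it holds, is decided by finitely many steps. -/
def FinitelyDecided (P : (ℕ → ℤ) → Prop) : Prop :=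
  ∀ x, P x → ∃ n, ∀ y : ℕ → ℤ, (∀ i ≤ n, y i = x i) → P y

/-- Initial paths which force the property `P`. -/
def forcing (P : (ℕ → ℤ) → Prop) (n : ℕ) : Set (Fin (n + 1) → ℤ) :=
  {v | ∀ y : ℕ → ℤ, (∀ i : Fin (n + 1), y i = v i) → P y}

lemma FinitelyDecided.setOf_eq {P : (ℕ → ℤ) → Prop} (hP : FinitelyDecided P)
    {α : Type*} (X : ℕ → α → ℤ) :
    {ω | P fun i => X i ω} = ⋃ n, initialPath X n ⁻¹' forcing P n := by
  ext ω
  simp only [Set.mem_ofPred_eq, Set.mem_iUnion, Set.mem_preimage, forcing, initialPath]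
  constructor
  · intro h
    obtain ⟨n, hn⟩ := hP _ h
    exact ⟨n, fun y hy => hn y fun i hi => hy ⟨i, by omega⟩⟩
  · rintro ⟨n, hn⟩
    exact hn _ fun i => rfl

lemma monotone_initialPath_forcing (P : (ℕ → ℤ) → Prop) {α : Type*}
    (X : ℕ → α → ℤ) :
    Monotone fun n => initialPath X n ⁻¹' forcing P n :=
  fun m n hmn _ hω y hy => hω y fun i => hy ⟨i, by omega⟩

lemma FinitelyDecided.measurableSet {P : (ℕ → ℤ) → Prop} (hP : FinitelyDecided P)
    (hX : ∀ n, Measurable (X n)) : MeasurableSet {ω | P fun i => X i ω} := by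
  rw [hP.setOf_eq]
  exact MeasurableSet.iUnion fun n => measurable_initialPath hX n MeasurableSet.of_discrete

lemma FinitelyDecided.measure_eq {P : (ℕ → ℤ) → Prop} (hP : FinitelyDecided P)
    (hX : IsSRW μ w X) (hY : IsSRW ν w Y) :
    μ {ω | P fun i => X i ω} = ν {ω | P fun i => Y i ω} := by
  rw [hP.setOf_eq, hP.setOf_eq, (monotone_initialPath_forcing P X).measure_iUnion,
    (monotone_initialPath_forcing P Y).measure_iUnion]
  refine iSup_congr fun n => ?_
  rw [← Measure.map_apply (measurable_initialPath hX.1 n) MeasurableSet.of_discrete,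
    ← Measure.map_apply (measurable_initialPath hY.1 n) MeasurableSet.of_discrete,
    hX.map_initialPath_eq hY]

end Transfer

/-! ### Edge balance and the least action principle -/

lemma dirLocP_add_eq {x : ℕ → ℤ} (h0 : x 0 = 0)
    (hx : ∀ n, x (n + 1) = x n + 1 ∨ x (n + 1) = x n - 1) (n : ℕ) (k : ℤ) :
    dirLocP x n k + (if x n ≤ k ∧ k < 0 then 1 else 0) =
      dirLocM x n (k + 1) + if 0 ≤ k ∧ k < x n then 1 else 0 := by
  induction n with
  | zero =>
    have h1 : ¬ (0 ≤ k ∧ k < 0) := by omega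
    simp [dirLocP, dirLocM, h0, h1]
  | succ n ih =>
    rw [dirLocP_succ, dirLocM_succ]
    rcases hx n with h | h <;> rw [h] <;> split_ifs at ih ⊢ <;> omega

lemma coinWalk_step (c : Coins) (n : ℕ) :
    coinWalk c (n + 1) = coinWalk c n + 1 ∨ coinWalk c (n + 1) = coinWalk c n - 1 := by
  rw [coinWalk_succ]
  split_ifs
  · exact Or.inl rfl
  · exact Or.inr rfl

lemma HitLeft.le_of_lt {k : ℤ} {d e : ℕ} {c : Coins} (h : HitLeft k d e c) {m : ℕ}
    (hm : (siteState c k m).2 < d) : (siteState c k m).1 ≤ e := by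
  cases d with
  | zero => omega
  | succ d =>
    obtain ⟨h1, h2⟩ := h
    have h3 : siteState c k (e + d + 1) = (e, d + 1) := by simp [siteState, h1, h2]
    by_contra! hlt
    have h4 := siteState_add c k m
    have h5 := siteState_snd_mono c k (show e + d + 1 ≤ m ∨ m ≤ e + d by omega |>.resolve_right
      fun h6 => by
        have := siteState_fst_mono c k h6
        simp only [h1] at this
        omega)
    simp only [h3] at h5
    omega

lemma HitLeft.le_of_le {k : ℤ} {d e : ℕ} {c : Coins} (h : HitLeft k d e c) {m : ℕ}
    (hm : d ≤ (siteState c k m).2) : e ≤ (siteState c k m).1 := by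
  cases d with
  | zero => exact (show e = 0 from h) ▸ Nat.zero_le _
  | succ d =>
    obtain ⟨h1, h2⟩ := h
    have h5 : e + d ≤ m := by
      by_contra! h6
      have := siteState_snd_mono c k h6.le
      simp only [h1] at this
      omega
    have := siteState_fst_mono c k h5
    simpa only [h1] using this

lemma HitRight.le_of_lt {k : ℤ} {d e : ℕ} {c : Coins} (h : HitRight k d e c) {m : ℕ}
    (hm : (siteState c k m).1 < d) : (siteState c k m).2 ≤ e := by
  cases d with
  | zero => omega
  | succ d =>
    obtain ⟨h1, h2⟩ := h
    have h3 : siteState c k (d + e + 1) = (d + 1, e) := by simp [siteState, h1, h2]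
    by_contra! hlt
    have h5 := siteState_fst_mono c k (show d + e + 1 ≤ m ∨ m ≤ d + e by omega |>.resolve_right
      fun h6 => by
        have := siteState_snd_mono c k h6
        simp only [h1] at this
        omega)
    simp only [h3] at h5
    omega

lemma HitRight.le_of_le {k : ℤ} {d e : ℕ} {c : Coins} (h : HitRight k d e c) {m : ℕ}
    (hm : d ≤ (siteState c k m).1) : e ≤ (siteState c k m).2 := by
  cases d with
  | zero => exact (show e = 0 from h) ▸ Nat.zero_le _
  | succ d =>
    obtain ⟨h1, h2⟩ := h
    have h5 : d + e ≤ m := by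
      by_contra! h6
      have := siteState_fst_mono c k h6.le
      simp only [h1] at this
      omega
    have := siteState_snd_mono c k h5
    simpa only [h1] using this

lemma le_sum_dirLoc {x : ℕ → ℤ} (hx : ∀ n, x (n + 1) = x n + 1 ∨ x (n + 1) = x n - 1)
    {S : Finset ℤ} {n : ℕ} (hS : ∀ i < n, x i ∈ S) :
    n ≤ ∑ k ∈ S, (dirLocP x n k + dirLocM x n k) := by
  induction n with
  | zero => exact Nat.zero_le _
  | succ n ih =>
    refine Nat.succ_le_of_lt ((ih fun i hi => hS i (by omega)).trans_lt ?_)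
    refine Finset.sum_lt_sum (fun k _ => add_le_add (dirLocP_mono x k n.le_succ)
      (dirLocM_mono x k n.le_succ)) ⟨x n, hS n n.lt_succ_self, ?_⟩
    rw [dirLocP_succ, dirLocM_succ]
    rcases hx n with h | h <;> simp [h] <;> omega

/-- A candidate profile `E` of left steps at the time of the `r`-th step to the right from `j`:
every site has been left exactly as often as required by the coins. -/
structure IsProfile (c : Coins) (j r : ℕ) (E : ℤ → ℕ) : Prop where
  start : E (j + 1) + 1 = r
  right : ∀ k : ℤ, j < k → HitLeft k (E k) (E (k + 1)) c
  mid : ∀ k : ℤ, 0 ≤ k → k ≤ j → HitRight k (E (k + 1) + 1) (E k) c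
  left : ∀ k : ℤ, k < 0 → HitRight k (E (k + 1)) (E k) c

namespace IsProfile

variable {c : Coins} {j r : ℕ} {E : ℤ → ℕ}

lemma dirLocM_le_of_lt (hE : IsProfile c j r E) {k : ℤ} (hk : k ≤ j) {n : ℕ}
    (h : dirLocP (coinWalk c) n k < E (k + 1) + if 0 ≤ k ∧ k ≤ j then 1 else 0) :
    dirLocM (coinWalk c) n k ≤ E k := by
  by_cases h0 : 0 ≤ k
  · have := (hE.mid k h0 hk).le_of_lt
      (m := dirLocP (coinWalk c) n k + dirLocM (coinWalk c) n k)
    simp only [siteState_dirLoc] at this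
    exact this (by simpa [h0, hk] using h)
  · have := (hE.left k (not_le.1 h0)).le_of_lt
      (m := dirLocP (coinWalk c) n k + dirLocM (coinWalk c) n k)
    simp only [siteState_dirLoc] at this
    exact this (by simpa [h0] using h)

lemma le_dirLocM_of_le (hE : IsProfile c j r E) {k : ℤ} (hk : k ≤ j) {n : ℕ}
    (h : (E (k + 1) + if 0 ≤ k ∧ k ≤ j then 1 else 0) ≤ dirLocP (coinWalk c) n k) :
    E k ≤ dirLocM (coinWalk c) n k := by
  by_cases h0 : 0 ≤ k
  · have := (hE.mid k h0 hk).le_of_le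
      (m := dirLocP (coinWalk c) n k + dirLocM (coinWalk c) n k)
    simp only [siteState_dirLoc] at this
    exact this (by simpa [h0, hk] using h)
  · have := (hE.left k (not_le.1 h0)).le_of_le
      (m := dirLocP (coinWalk c) n k + dirLocM (coinWalk c) n k)
    simp only [siteState_dirLoc] at this
    exact this (by simpa [h0] using h)

lemma dirLocP_le_of_lt (hE : IsProfile c j r E) {k : ℤ} (hk : j < k) {n : ℕ}
    (h : dirLocM (coinWalk c) n k < E k) : dirLocP (coinWalk c) n k ≤ E (k + 1) := by
  have := (hE.right k hk).le_of_lt (m := dirLocP (coinWalk c) n k + dirLocM (coinWalk c) n k)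
  simp only [siteState_dirLoc] at this
  exact this h

lemma le_dirLocP_of_le (hE : IsProfile c j r E) {k : ℤ} (hk : j < k) {n : ℕ}
    (h : E k ≤ dirLocM (coinWalk c) n k) : E (k + 1) ≤ dirLocP (coinWalk c) n k := by
  have := (hE.right k hk).le_of_le (m := dirLocP (coinWalk c) n k + dirLocM (coinWalk c) n k)
  simp only [siteState_dirLoc] at this
  exact this h

lemma dirLoc_le (hE : IsProfile c j r E) {n : ℕ} (hn : ∀ m < n, dirLocP (coinWalk c) m j < r)
    (k : ℤ) : dirLocP (coinWalk c) n k ≤ E (k + 1) + (if 0 ≤ k ∧ k ≤ j then 1 else 0) ∧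
      dirLocM (coinWalk c) n k ≤ E k := by
  induction n generalizing k with
  | zero => simp [dirLocP, dirLocM]
  | succ n ih =>
    have ih' := ih fun m hm => hn m (by omega)
    have hP := dirLocP_succ (coinWalk c) n k
    have hM := dirLocM_succ (coinWalk c) n k
    by_cases hk : coinWalk c n = k
    swap
    · simp only [hk, false_and, if_false, add_zero] at hP hM
      rw [hP, hM]
      exact ih' k
    have hb1 := dirLocP_add_eq (by rfl : coinWalk c 0 = 0) (coinWalk_step c) n k
    have hb2 := dirLocP_add_eq (by rfl : coinWalk c 0 = 0) (coinWalk_step c) n (k - 1)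
    have hk1 := (ih' (k + 1)).2
    have hk2 := (ih' (k - 1)).1
    obtain ⟨hPk, hMk⟩ := ih' k
    have hj := hn n n.lt_succ_self
    have hs := hE.start
    rw [hk] at hb1 hb2
    rw [sub_add_cancel] at hb2 hk2
    rw [if_neg (by omega : ¬ (0 ≤ k ∧ k < k))] at hb1
    rw [if_neg (by omega : ¬ (k ≤ k - 1 ∧ k - 1 < 0))] at hb2
    have hstep : dirLocP (coinWalk c) (n + 1) k + dirLocM (coinWalk c) (n + 1) k =
        dirLocP (coinWalk c) n k + dirLocM (coinWalk c) n k + 1 := by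
      rw [hP, hM]
      rcases coinWalk_step c n with h | h <;> rw [h, hk] <;>
        simp [show ¬ k + 1 = k - 1 by omega, show ¬ k - 1 = k + 1 by omega] <;> omega
    have hP' := dirLocP_mono (coinWalk c) k n.le_succ
    have hM' := dirLocM_mono (coinWalk c) k n.le_succ
    simp only at hP' hM'
    by_cases hkj : k ≤ j
    · have h1 := hE.dirLocM_le_of_lt hkj (n := n + 1)
      have h2 := hE.le_dirLocM_of_le hkj (n := n)
      split_ifs at * <;> omega
    · have h1 := hE.dirLocP_le_of_lt (not_le.1 hkj) (n := n + 1)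
      have h2 := hE.le_dirLocP_of_le (not_le.1 hkj) (n := n)
      by_cases hkj' : k = j + 1
      · subst hkj'
        rw [add_sub_cancel_right] at hb2 hk2
        split_ifs at * <;> omega
      · split_ifs at * <;> omega

lemma exists_le_dirLocP (hE : IsProfile c j r E) {L : ℤ} (hL : ∀ k, E k ≠ 0 → -L ≤ k ∧ k ≤ L)
    (hjL : j ≤ L) : ∃ n, r ≤ dirLocP (coinWalk c) n j := by
  by_contra! hlt
  have hle := fun n k => hE.dirLoc_le (n := n) (fun m _ => hlt m) k
  set S := Finset.Icc (-L - 1) L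
  have hS : ∀ i, coinWalk c i ∈ S := by
    intro i
    by_contra hi
    have h1 := hle (i + 1) (coinWalk c i)
    rw [dirLocP_succ, dirLocM_succ] at h1
    have h2 := hL (coinWalk c i)
    have h3 := hL (coinWalk c i + 1)
    simp only [S, Finset.mem_Icc, not_and_or] at hi
    have h4 : E (coinWalk c i) = 0 := by by_contra h; have := h2 h; omega
    have h5 : E (coinWalk c i + 1) = 0 := by by_contra h; have := h3 h; omega
    rw [if_neg (by omega : ¬ (0 ≤ coinWalk c i ∧ coinWalk c i ≤ j)), h4, h5] at h1
    rcases coinWalk_step c i with h | h <;> simp [h] at h1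
  have h1 := le_sum_dirLoc (coinWalk_step c)
    (n := ∑ k ∈ S, (E (k + 1) + (if 0 ≤ k ∧ k ≤ (j : ℤ) then 1 else 0) + E k) + 1)
    fun i _ => hS i
  have h2 := h1.trans (Finset.sum_le_sum fun k _ => add_le_add (hle _ k).1 (hle _ k).2)
  omega

lemma LamP_eq (hE : IsProfile c j r E) (hex : ∃ n, r ≤ dirLocP (coinWalk c) n j) (k : ℤ) :
    LamP (coinWalk c) j r k = 2 * E (k + 1) + if 0 ≤ k ∧ k ≤ j then 1 else 0 := by
  have hT : r ≤ dirLocP (coinWalk c) (Tp (coinWalk c) j r) j := Nat.sInf_mem hex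
  have hlt : ∀ m < Tp (coinWalk c) j r, dirLocP (coinWalk c) m j < r :=
    fun m hm => not_le.1 fun h => Nat.notMem_of_lt_sInf hm h
  rw [LamP]
  revert hT hlt
  generalize Tp (coinWalk c) j r = T
  intro hT hlt
  have hle := hE.dirLoc_le hlt
  have hs := hE.start
  cases T with
  | zero => simp [dirLocP] at hT; omega
  | succ T =>
    have hyT : coinWalk c (T + 1) = j + 1 := by
      have h1 := hlt T T.lt_succ_self
      rw [dirLocP_succ] at hT
      split_ifs at hT with h
      · exact h.2
      · omega
    have hb : ∀ k, dirLocP (coinWalk c) (T + 1) k =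
        dirLocM (coinWalk c) (T + 1) (k + 1) + if 0 ≤ k ∧ k ≤ j then 1 else 0 := by
      intro k
      have h := dirLocP_add_eq (by rfl : coinWalk c 0 = 0) (coinWalk_step c) (T + 1) k
      rw [hyT, if_neg (by omega : ¬ ((j : ℤ) + 1 ≤ k ∧ k < 0))] at h
      simpa [Int.lt_add_one_iff] using h
    have hbase : dirLocM (coinWalk c) (T + 1) (j + 1) = E (j + 1) := by
      have h1 := hb j
      have h2 := (hle (j + 1)).2
      rw [if_pos (by omega)] at h1
      omega
    have hup : ∀ i : ℕ, dirLocM (coinWalk c) (T + 1) (j + 1 + i) = E (j + 1 + i) := by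
      intro i
      induction i with
      | zero => simpa using hbase
      | succ i ih =>
        have h1 := hE.le_dirLocP_of_le (k := j + 1 + i) (n := T + 1) (by omega) ih.ge
        have h2 := hb (j + 1 + i)
        have h3 := (hle (j + 1 + i + 1)).2
        rw [if_neg (by omega)] at h2
        push_cast
        rw [← add_assoc]
        omega
    have hdown : ∀ i : ℕ, dirLocM (coinWalk c) (T + 1) (j + 1 - i) = E (j + 1 - i) := by
      intro i
      induction i with
      | zero => simpa using hbase
      | succ i ih =>
        have h2 := hb (j - i)
        have h3 := (hle (j - i)).2
        rw [show (j : ℤ) - i + 1 = j + 1 - i by ring, ih] at h2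
        have h1 := hE.le_dirLocM_of_le (k := j - i) (n := T + 1) (by omega)
          (by rw [show (j : ℤ) - i + 1 = j + 1 - i by ring]; exact h2.ge)
        rw [show (j : ℤ) + 1 - (i + 1 : ℕ) = j - i by push_cast; ring]
        omega
    have hall : dirLocM (coinWalk c) (T + 1) (k + 1) = E (k + 1) := by
      rcases le_total (j : ℤ) k with h | h
      · have := hup (k - j).toNat
        rwa [show (j : ℤ) + 1 + (k - j).toNat = k + 1 by omega] at this
      · have := hdown (j - k).toNat
        rwa [show (j : ℤ) + 1 - (j - k).toNat = k + 1 by omega] at this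
    rw [hb k, hall]
    ring

end IsProfile

/-- A trajectory of the chain which has died by time `n`. -/
lemma exists_of_mem_chainAt {H : ℕ → ℕ → ℕ → Coins → Prop} {r₀ J n : ℕ} {c : Coins}
    (hc : c ∈ ChainAt H r₀ J n 0) (hJ : J ≤ n) (hH : ∀ i, H i 0 0 c) :
    ∃ a : ℕ → ℕ, a 0 = r₀ ∧ (∀ i, H i (a i + if i < J then 1 else 0) (a (i + 1)) c) ∧
      ∀ i, n ≤ i → a i = 0 := by
  have key : ∀ n e, c ∈ ChainAt H r₀ J n e → ∃ a : ℕ → ℕ, a 0 = r₀ ∧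
      (∀ i < n, H i (a i + if i < J then 1 else 0) (a (i + 1)) c) ∧ ∀ i, n ≤ i → a i = e := by
    intro n
    induction n with
    | zero => exact fun e he => ⟨fun _ => e, he, by simp, fun _ _ => rfl⟩
    | succ n ih =>
      intro e he
      obtain ⟨d, hd, hde⟩ := Set.mem_iUnion.1 he
      obtain ⟨a, h0, h1, h2⟩ := ih d hd
      refine ⟨fun i => if i ≤ n then a i else e, by simpa using h0, fun i hi => ?_, fun i hi => ?_⟩
      · simp only [show i ≤ n by omega, if_true]
        rcases Nat.lt_or_ge i n with hin | hin
        · simpa only [show i + 1 ≤ n by omega, if_true] using h1 i hin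
        · obtain rfl : i = n := by omega
          simpa [h2 i le_rfl] using hde
      · simp [show ¬ i ≤ n by omega]
  obtain ⟨a, h0, h1, h2⟩ := key n 0 hc
  refine ⟨a, h0, fun i => ?_, h2⟩
  rcases Nat.lt_or_ge i n with hin | hin
  · exact h1 i hin
  · rw [h2 i hin, h2 (i + 1) (by omega), if_neg (by omega)]
    exact hH i

lemma mem_chainAt {H : ℕ → ℕ → ℕ → Coins → Prop} {r₀ J : ℕ} {c : Coins} {a : ℕ → ℕ}
    (h0 : a 0 = r₀) (h1 : ∀ i, H i (a i + if i < J then 1 else 0) (a (i + 1)) c) (i : ℕ) :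
    c ∈ ChainAt H r₀ J i (a i) := by
  induction i with
  | zero => exact h0
  | succ i ih => exact Set.mem_iUnion.2 ⟨a i, ih, h1 i⟩

/-- The visited edges at the inverse local time, in terms of the extinction of the chains to the
right and to the left of `j`. -/
lemma edges_of_mem_chainAt {c : Coins} {j r n₀ n₁ m₀ m₁ : ℕ} (hr : 1 ≤ r)
    (hn₁ : c ∈ ChainAt (fun i => HitLeft (j + 1 + i)) (r - 1) 0 n₁ 0)
    (hn₀ : c ∉ ChainAt (fun i => HitLeft (j + 1 + i)) (r - 1) 0 n₀ 0)
    (hm₁ : c ∈ ChainAt (fun i => HitRight (j - i)) (r - 1) (j + 1) (j + 1 + m₁) 0)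
    (hm₀ : c ∉ ChainAt (fun i => HitRight (j - i)) (r - 1) (j + 1) (j + 1 + m₀) 0) :
    (∃ n, r ≤ dirLocP (coinWalk c) n j) ∧ ∃ l ρ : ℤ,
      IsLeast {k | 0 < LamP (coinWalk c) j r k} l ∧
      IsGreatest {k | 0 < LamP (coinWalk c) j r k} ρ ∧
      -(m₁ : ℤ) ≤ l ∧ l ≤ -m₀ - 1 ∧ (j : ℤ) + n₀ ≤ ρ ∧ ρ ≤ j + n₁ := by
  obtain ⟨a, ha0, ha1, ha2⟩ := exists_of_mem_chainAt hn₁ (Nat.zero_le _) fun i => rfl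
  obtain ⟨b, hb0, hb1, hb2⟩ := exists_of_mem_chainAt hm₁ (by omega) fun i => rfl
  have ha3 : a n₀ ≠ 0 := fun h => hn₀ (h ▸ mem_chainAt ha0 ha1 n₀)
  have hb3 : b (j + 1 + m₀) ≠ 0 := fun h => hm₀ (by
    have := mem_chainAt hb0 hb1 (j + 1 + m₀)
    rwa [h] at this)
  set E : ℤ → ℕ := fun k => if j < k then a (k - (j + 1)).toNat else b (j + 1 - k).toNat with hEdef
  have hEa : ∀ i : ℕ, E (j + 1 + i) = a i := by
    intro i
    simp [hEdef, show (j : ℤ) < j + 1 + i by omega]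
  have hEb : ∀ i : ℕ, E (j + 1 - i) = b i := by
    intro i
    cases i with
    | zero => simp [hEdef, ha0, hb0]
    | succ i =>
      simp only [hEdef]
      rw [if_neg (by omega)]
      congr 1
      omega
  have hE : IsProfile c j r E := by
    refine ⟨?_, fun k hk => ?_, fun k hk hkj => ?_, fun k hk => ?_⟩
    · have := hEa 0
      simp only [Nat.cast_zero, add_zero] at this
      omega
    · obtain ⟨i, rfl⟩ : ∃ i : ℕ, k = j + 1 + i := ⟨(k - (j + 1)).toNat, by omega⟩
      rw [hEa, show (j : ℤ) + 1 + i + 1 = j + 1 + (i + 1 : ℕ) by push_cast; ring, hEa]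
      simpa using ha1 i
    · obtain ⟨i, rfl⟩ : ∃ i : ℕ, k = j - i := ⟨(j - k).toNat, by omega⟩
      have := hb1 i
      rw [if_pos (by omega)] at this
      rwa [show (j : ℤ) - i + 1 = j + 1 - i by ring, hEb,
        show (j : ℤ) - i = j + 1 - (i + 1 : ℕ) by push_cast; ring, hEb,
        show (j : ℤ) + 1 - (i + 1 : ℕ) = j - i by push_cast; ring]
    · obtain ⟨i, rfl⟩ : ∃ i : ℕ, k = j - i := ⟨(j - k).toNat, by omega⟩
      have := hb1 i
      rw [if_neg (by omega)] at this
      rwa [show (j : ℤ) - i + 1 = j + 1 - i by ring, hEb,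
        show (j : ℤ) - i = j + 1 - (i + 1 : ℕ) by push_cast; ring, hEb,
        show (j : ℤ) + 1 - (i + 1 : ℕ) = j - i by push_cast; ring]
  have hzr : ∀ k : ℤ, j + 1 + n₁ ≤ k → E k = 0 := by
    intro k hk
    obtain ⟨i, rfl⟩ : ∃ i : ℕ, k = j + 1 + i := ⟨(k - (j + 1)).toNat, by omega⟩
    rw [hEa, ha2 i (by omega)]
  have hzl : ∀ k : ℤ, k ≤ -m₁ → E k = 0 := by
    intro k hk
    obtain ⟨i, rfl⟩ : ∃ i : ℕ, k = j + 1 - i := ⟨(j + 1 - k).toNat, by omega⟩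
    rw [hEb, hb2 i (by omega)]
  have hex := hE.exists_le_dirLocP (L := j + n₁ + m₁) (fun k hk => by
    have h1 := mt (hzr k) hk
    have h2 := mt (hzl k) hk
    omega) (by omega)
  have hlow : ∀ k : ℤ, 0 < LamP (coinWalk c) j r k → -(m₁ : ℤ) ≤ k := by
    intro k hk
    by_contra! h
    rw [hE.LamP_eq hex, hzl (k + 1) (by omega), if_neg (by omega)] at hk
    omega
  have hhigh : ∀ k : ℤ, 0 < LamP (coinWalk c) j r k → k ≤ j + n₁ := by
    intro k hk
    by_contra! h
    rw [hE.LamP_eq hex, hzr (k + 1) (by omega), if_neg (by omega)] at hk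
    omega
  have h1 : 0 < LamP (coinWalk c) j r (j + n₀) := by
    have := hEa n₀
    rw [hE.LamP_eq hex, show (j : ℤ) + n₀ + 1 = j + 1 + n₀ by ring]
    omega
  have h2 : 0 < LamP (coinWalk c) j r (-m₀ - 1) := by
    have := hEb (j + 1 + m₀)
    rw [show (j : ℤ) + 1 - (j + 1 + m₀ : ℕ) = -m₀ - 1 + 1 by push_cast; ring] at this
    rw [hE.LamP_eq hex]
    omega
  have hl : IsLeast {k | 0 < LamP (coinWalk c) j r k} (sInf {k | 0 < LamP (coinWalk c) j r k}) :=
    ⟨Int.csInf_mem ⟨_, h2⟩ ⟨_, hlow⟩, fun k hk => csInf_le ⟨_, hlow⟩ hk⟩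
  have hρ : IsGreatest {k | 0 < LamP (coinWalk c) j r k}
      (sSup {k | 0 < LamP (coinWalk c) j r k}) :=
    ⟨Int.csSup_mem ⟨_, h1⟩ ⟨_, hhigh⟩, fun k hk => le_csSup ⟨_, hhigh⟩ hk⟩
  exact ⟨hex, _, _, hl, hρ, hlow _ hl.1, hl.2 h2, hρ.2 h1, hhigh _ hρ.1⟩

/-! ### Ranges of visited edges -/

/-- The extremities of the set `S`, rescaled by `A`, are `ε`-close to `-s` and `s`. -/
def SpansNear (A s ε : ℝ) (S : Set ℤ) : Prop :=
  ∃ l ρ : ℤ, IsLeast S l ∧ IsGreatest S ρ ∧ |A⁻¹ * l - -s| ≤ ε ∧ |A⁻¹ * ρ - s| ≤ ε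

/-- The time `T⁺_{j,r}` is finite and the extreme visited edges are `ε`-close to `∓ s`. -/
def GoodP (A s ε : ℝ) (j : ℤ) (r : ℕ) (x : ℕ → ℤ) : Prop :=
  (∃ n, r ≤ dirLocP x n j) ∧ SpansNear A s ε {k | 0 < LamP x j r k}

/-- The time `T⁻_{j,r}` is finite and the extreme visited edges are `ε`-close to `∓ s`. -/
def GoodM (A s ε : ℝ) (j : ℤ) (r : ℕ) (x : ℕ → ℤ) : Prop :=
  (∃ n, r ≤ dirLocM x n j) ∧ SpansNear A s ε {k | 0 < LamM x j r k}

lemma finitelyDecided_goodP (A s ε : ℝ) (j : ℤ) (r : ℕ) : FinitelyDecided (GoodP A s ε j r) := by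
  rintro x ⟨hex, h⟩
  have hT : r ≤ dirLocP x (Tp x j r) j := Nat.sInf_mem hex
  refine ⟨Tp x j r, fun y hy => ?_⟩
  have hyT : r ≤ dirLocP y (Tp x j r) j := by rwa [dirLocP_congr hy]
  have hTy : Tp y j r = Tp x j r := by
    refine le_antisymm (Nat.sInf_le hyT) ?_
    by_contra! hlt
    have h1 : r ≤ dirLocP y (Tp y j r) j := Nat.sInf_mem (s := {n | r ≤ dirLocP y n j}) ⟨_, hyT⟩
    rw [dirLocP_congr (fun i hi => hy i (hi.trans hlt.le))] at h1
    exact Nat.notMem_of_lt_sInf hlt h1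
  have hLam : LamP y j r = LamP x j r := by
    ext k
    rw [LamP, LamP, hTy, dirLocP_congr hy, dirLocM_congr hy]
  exact ⟨⟨_, hyT⟩, by rwa [hLam]⟩

lemma SpansNear.of_subset {A s ε : ℝ} (hA : 0 < A) {S T U : Set ℤ} (hST : S ⊆ T) (hTU : T ⊆ U)
    (hS : SpansNear A s ε S) (hU : SpansNear A s ε U) : SpansNear A s ε T := by
  obtain ⟨l, ρ, hl, hρ, hls, hρs⟩ := hS
  obtain ⟨l', ρ', hl', hρ', hls', hρs'⟩ := hU
  have hne : T.Nonempty := ⟨l, hST hl.1⟩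
  have hbb : BddBelow T := ⟨l', fun k hk => hl'.2 (hTU hk)⟩
  have hba : BddAbove T := ⟨ρ', fun k hk => hρ'.2 (hTU hk)⟩
  have h1 : IsLeast T (sInf T) := ⟨Int.csInf_mem hne hbb, fun k hk => csInf_le hbb hk⟩
  have h2 : IsGreatest T (sSup T) := ⟨Int.csSup_mem hne hba, fun k hk => le_csSup hba hk⟩
  refine ⟨_, _, h1, h2, ?_, ?_⟩
  · have h3 : (l' : ℝ) ≤ sInf T := by exact_mod_cast hl'.2 (hTU h1.1)
    have h4 : ((sInf T : ℤ) : ℝ) ≤ l := by exact_mod_cast h1.2 (hST hl.1)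
    have h5 := mul_le_mul_of_nonneg_left h3 (inv_pos.2 hA).le
    have h6 := mul_le_mul_of_nonneg_left h4 (inv_pos.2 hA).le
    rw [abs_le] at *
    constructor <;> linarith
  · have h3 : ((sSup T : ℤ) : ℝ) ≤ ρ' := by exact_mod_cast hρ'.2 (hTU h2.1)
    have h4 : (ρ : ℝ) ≤ sSup T := by exact_mod_cast h2.2 (hST hρ.1)
    have h5 := mul_le_mul_of_nonneg_left h3 (inv_pos.2 hA).le
    have h6 := mul_le_mul_of_nonneg_left h4 (inv_pos.2 hA).le
    rw [abs_le] at *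
    constructor <;> linarith

lemma SpansNear.reflect {A s ε : ℝ} (hA : 0 < A) (hAε : A⁻¹ ≤ ε) {S : Set ℤ}
    (hS : SpansNear A s ε S) : SpansNear A s (2 * ε) {k | -k - 1 ∈ S} := by
  obtain ⟨l, ρ, hl, hρ, hls, hρs⟩ := hS
  have hA' := inv_pos.2 hA
  refine ⟨-ρ - 1, -l - 1, ⟨?_, fun k hk => ?_⟩, ⟨?_, fun k hk => ?_⟩, ?_, ?_⟩
  · rw [Set.mem_ofPred_eq]
    convert hρ.1 using 1
    ring
  · have := hρ.2 hk
    omega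
  · rw [Set.mem_ofPred_eq]
    convert hl.1 using 1
    ring
  · have := hl.2 hk
    omega
  · push_cast
    rw [abs_le] at *
    constructor <;> linarith
  · push_cast
    rw [abs_le] at *
    constructor <;> linarith

lemma dirLocP_neg (x : ℕ → ℤ) (n : ℕ) (k : ℤ) :
    dirLocP (fun i => -x i) n k = dirLocM x n (-k) := by
  simp only [dirLocP, dirLocM]
  congr 1
  refine Finset.filter_congr fun i _ => ?_
  omega

lemma dirLocM_neg (x : ℕ → ℤ) (n : ℕ) (k : ℤ) :
    dirLocM (fun i => -x i) n k = dirLocP x n (-k) := by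
  simp only [dirLocP, dirLocM]
  congr 1
  refine Finset.filter_congr fun i _ => ?_
  omega

lemma Tp_neg (x : ℕ → ℤ) (j : ℤ) (r : ℕ) : Tp (fun i => -x i) j r = Tm x (-j) r := by
  simp only [Tp, Tm, dirLocP_neg]

lemma Tm_neg (x : ℕ → ℤ) (j : ℤ) (r : ℕ) : Tm (fun i => -x i) j r = Tp x (-j) r := by
  simp only [Tp, Tm, dirLocM_neg]

lemma LamP_neg (x : ℕ → ℤ) (j : ℤ) (r : ℕ) (k : ℤ) :
    LamP (fun i => -x i) j r k = LamM x (-j) r (-k - 1) := by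
  rw [LamP, LamM, Tp_neg, dirLocP_neg, dirLocM_neg, add_comm, neg_add', sub_add_cancel]

lemma LamM_neg (x : ℕ → ℤ) (j : ℤ) (r : ℕ) (k : ℤ) :
    LamM (fun i => -x i) j r k = LamP x (-j) r (-k - 1) := by
  rw [LamP, LamM, Tm_neg, dirLocP_neg, dirLocM_neg, add_comm, neg_add', sub_add_cancel]

lemma GoodP.reflect {A s ε : ℝ} (hA : 0 < A) (hAε : A⁻¹ ≤ ε) {j : ℤ} {r : ℕ} {x : ℕ → ℤ}
    (h : GoodP A s ε j r fun i => -x i) : GoodM A s (2 * ε) (-j) r x := by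
  obtain ⟨⟨n, hn⟩, hs⟩ := h
  refine ⟨⟨n, by rwa [dirLocP_neg] at hn⟩, ?_⟩
  have := hs.reflect hA hAε
  simpa only [LamP_neg, Set.mem_ofPred_eq, neg_sub, sub_neg_eq_add, add_sub_cancel_left] using this

lemma GoodM.reflect {A s ε : ℝ} (hA : 0 < A) (hAε : A⁻¹ ≤ ε) {j : ℤ} {r : ℕ} {x : ℕ → ℤ}
    (h : GoodM A s ε j r fun i => -x i) : GoodP A s (2 * ε) (-j) r x := by
  obtain ⟨⟨n, hn⟩, hs⟩ := h
  refine ⟨⟨n, by rwa [dirLocM_neg] at hn⟩, ?_⟩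
  have := hs.reflect hA hAε
  simpa only [LamM_neg, Set.mem_ofPred_eq, neg_sub, sub_neg_eq_add, add_sub_cancel_left] using this

lemma goodM_of_goodP {x : ℕ → ℤ} (h0 : x 0 = 0)
    (hx : ∀ n, x (n + 1) = x n + 1 ∨ x (n + 1) = x n - 1) {A s ε : ℝ} (hA : 0 < A) {j r : ℕ}
    (h : GoodP A s ε j r x) (h' : GoodP A s ε j (r + 1) x) : GoodM A s ε (j + 1) r x := by
  have hb : ∀ n, dirLocM x n (j + 1) ≤ dirLocP x n j ∧
      dirLocP x n j ≤ dirLocM x n (j + 1) + 1 := by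
    intro n
    have := dirLocP_add_eq h0 hx n j
    rw [if_neg (by omega)] at this
    split_ifs at this <;> omega
  have hT' : r + 1 ≤ dirLocP x (Tp x j (r + 1)) j := Nat.sInf_mem h'.1
  have hM' : r ≤ dirLocM x (Tp x j (r + 1)) (j + 1) := by have := hb (Tp x j (r + 1)); omega
  have hM : r ≤ dirLocM x (Tm x (j + 1) r) (j + 1) :=
    Nat.sInf_mem (s := {n | r ≤ dirLocM x n (j + 1)}) ⟨_, hM'⟩
  have hle' : Tm x (j + 1) r ≤ Tp x j (r + 1) := Nat.sInf_le hM'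
  have hle : Tp x j r ≤ Tm x (j + 1) r := Nat.sInf_le (hM.trans (hb _).1)
  refine ⟨⟨_, hM⟩, h.2.of_subset hA (fun k hk => ?_) (fun k hk => ?_) h'.2⟩
  · exact lt_of_lt_of_le hk (add_le_add (dirLocP_mono x k hle) (dirLocM_mono x (k + 1) hle))
  · exact lt_of_lt_of_le hk (add_le_add (dirLocP_mono x k hle') (dirLocM_mono x (k + 1) hle'))

/-! ### The walk and its reflection -/

lemma stepProb_neg (w : ℤ → ℝ) (x : ℕ → ℤ) (n : ℕ) :
    stepProb w (fun i => -x i) n = stepProb w x n := by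
  simp only [stepProb, dirLocP_neg, dirLocM_neg, neg_neg, neg_sub]
  have h1 : -x (n + 1) = -x n + 1 ↔ x (n + 1) = x n - 1 := by omega
  have h2 : -x (n + 1) = -x n - 1 ↔ x (n + 1) = x n + 1 := by omega
  simp only [h1, h2]
  split_ifs
  · omega
  · rw [add_comm]
  · rw [add_comm]
  · rfl

lemma IsSRW.neg {Ω : Type*} [MeasurableSpace Ω] {μ : Measure Ω} {w : ℤ → ℝ} {X : ℕ → Ω → ℤ}
    (hX : IsSRW μ w X) : IsSRW μ w fun n ω => -X n ω := by
  refine ⟨fun n => (hX.1 n).neg, by simpa using hX.2.1, fun n x => ?_⟩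
  have := hX.2.2 n fun i => -x i
  rw [stepProb_neg] at this
  simpa only [neg_eq_iff_eq_neg] using this

section Walk

variable {Ω : Type*} [MeasurableSpace Ω] {μ : Measure Ω} [IsProbabilityMeasure μ] {w : ℤ → ℝ}
  {X : ℕ → Ω → ℤ}

lemma IsSRW.ae_step (hp : ∀ z, 0 < w z) (hX : IsSRW μ w X) :
    μ {ω | ¬ (X 0 ω = 0 ∧ ∀ n, X (n + 1) ω = X n ω + 1 ∨ X (n + 1) ω = X n ω - 1)} = 0 := by
  have hfd : FinitelyDecided
      fun x => ¬ (x 0 = 0 ∧ ∀ n, x (n + 1) = x n + 1 ∨ x (n + 1) = x n - 1) := by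
    intro x hx
    by_cases h0 : x 0 = 0
    · have : ∃ n, ¬ (x (n + 1) = x n + 1 ∨ x (n + 1) = x n - 1) := by
        by_contra! h
        exact hx ⟨h0, h⟩
      obtain ⟨n, hn⟩ := this
      refine ⟨n + 1, fun y hy h => hn ?_⟩
      rw [← hy n (by omega), ← hy (n + 1) le_rfl]
      exact h.2 n
    · exact ⟨0, fun y hy h => h0 (by rw [← hy 0 le_rfl]; exact h.1)⟩
  have := hfd.measure_eq hX (isSRW_coinWalk hp)
  refine this.trans ?_
  have hempty : {c : Coins | ¬ (coinWalk c 0 = 0 ∧ ∀ n, coinWalk c (n + 1) = coinWalk c n + 1 ∨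
      coinWalk c (n + 1) = coinWalk c n - 1)} = ∅ :=
    Set.eq_empty_of_forall_notMem fun c hc => hc ⟨rfl, coinWalk_step c⟩
  rw [hempty, measure_empty]

end Walk

/-! ### Convergence in probability -/

lemma IsSRW.measure_not_goodP_le {Ω : Type*} [MeasurableSpace Ω] {μ : Measure Ω}
    [IsProbabilityMeasure μ] {w : ℤ → ℝ} {X : ℕ → Ω → ℤ} (hp : ∀ z, 0 < w z) (hX : IsSRW μ w X)
    {A s ε : ℝ} {j r n₀ n₁ m₀ m₁ : ℕ} (hr : 1 ≤ r) (hA : 0 < A)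
    (hn₀ : s - ε ≤ A⁻¹ * (j + n₀)) (hn₁ : A⁻¹ * (j + n₁) ≤ s + ε)
    (hm₀ : s - ε ≤ A⁻¹ * (m₀ + 1)) (hm₁ : A⁻¹ * m₁ ≤ s + ε) :
    μ {ω | ¬ GoodP A s ε j r fun i => X i ω} ≤
      ENNReal.ofReal (1 - (chainLaw w (r - 1) 0 n₁ 0).toReal) + chainLaw w (r - 1) 0 n₀ 0 +
      ENNReal.ofReal (1 - (chainLaw w (r - 1) (j + 1) (j + 1 + m₁) 0).toReal) +
      chainLaw w (r - 1) (j + 1) (j + 1 + m₀) 0 := by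
  have hR : ∀ i : ℕ, IsRound w ((j : ℤ) + 1 + i) (HitLeft (j + 1 + i)) :=
    fun i => isRound_hitLeft hp _
  have hL : ∀ i : ℕ, IsRound w ((j : ℤ) - i) (HitRight (j - i)) := fun i => isRound_hitRight hp _
  have hRk : Function.Injective fun i : ℕ => (j : ℤ) + 1 + i := fun a b h => by
    simpa using h
  have hLk : Function.Injective fun i : ℕ => (j : ℤ) - i := fun a b h => by simpa using h
  have hcompl : ∀ {k : ℕ → ℤ} {H : ℕ → ℕ → ℕ → Coins → Prop}, Function.Injective k →
      (∀ i, IsRound w (k i) (H i)) → ∀ J n, coinsLaw w (ChainAt H (r - 1) J n 0)ᶜ =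
        ENNReal.ofReal (1 - (chainLaw w (r - 1) J n 0).toReal) := by
    intro k H hk hH J n
    rw [prob_compl_eq_one_sub (coinsOn_le _ _ (measurableSet_chainAt hH _ _ _ _)),
      ← coinsLaw_chainAt hk hH, ← ENNReal.ofReal_one, ENNReal.ofReal_sub _ ENNReal.toReal_nonneg,
      ENNReal.ofReal_toReal (measure_ne_top _ _)]
  have hfd := finitelyDecided_goodP A s ε j r
  have heq : μ {ω | ¬ GoodP A s ε j r fun i => X i ω} =
      coinsLaw w {c | ¬ GoodP A s ε j r (coinWalk c)} := by
    have hS := isSRW_coinWalk hp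
    have h1 := prob_compl_eq_one_sub (μ := μ) (hfd.measurableSet hX.1)
    have h2 := prob_compl_eq_one_sub (μ := coinsLaw w) (hfd.measurableSet hS.1)
    rw [hfd.measure_eq hX hS, ← h2] at h1
    exact h1
  rw [heq, ← hcompl hRk hR, ← hcompl hLk hL, ← coinsLaw_chainAt hRk hR, ← coinsLaw_chainAt hLk hL]
  refine le_trans (measure_mono fun c hc => ?_) ((measure_union_le _ _).trans (add_le_add
    ((measure_union_le _ _).trans (add_le_add (measure_union_le _ _) le_rfl)) le_rfl))
  by_contra hnot
  simp only [Set.mem_union, Set.mem_compl_iff, not_or, not_not] at hnot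
  obtain ⟨⟨⟨h1, h0⟩, h3⟩, h2⟩ := hnot
  obtain ⟨hex, l, ρ, hl, hρ, hl1, hl0, hρ0, hρ1⟩ := edges_of_mem_chainAt hr h1 h0 h3 h2
  refine hc ⟨hex, l, ρ, hl, hρ, ?_, ?_⟩
  · have h4 : -(m₁ : ℝ) ≤ l := by exact_mod_cast hl1
    have h5 : (l : ℝ) ≤ -m₀ - 1 := by exact_mod_cast hl0
    have h6 := mul_le_mul_of_nonneg_left h4 (inv_pos.2 hA).le
    have h7 := mul_le_mul_of_nonneg_left h5 (inv_pos.2 hA).le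
    rw [abs_le]
    constructor <;> linarith
  · have h4 : (j : ℝ) + n₀ ≤ ρ := by exact_mod_cast hρ0
    have h5 : (ρ : ℝ) ≤ j + n₁ := by exact_mod_cast hρ1
    have h6 := mul_le_mul_of_nonneg_left h4 (inv_pos.2 hA).le
    have h7 := mul_le_mul_of_nonneg_left h5 (inv_pos.2 hA).le
    rw [abs_le]
    constructor <;> linarith

lemma tendsto_toNat_floor_div {a : ℝ} (ha : 0 ≤ a) :
    Tendsto (fun A : ℝ => (⌊A * a⌋.toNat : ℝ) / A) atTop (𝓝 a) := by
  refine (tendsto_nat_floor_mul_div_atTop ha).congr fun A => ?_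
  rw [Int.floor_toNat, mul_comm]

lemma tendsto_const_div_atTop_zero (c : ℝ) : Tendsto (fun A : ℝ => c / A) atTop (𝓝 0) :=
  tendsto_const_nhds.div_atTop tendsto_id

lemma tendsto_sub_one_div {r : ℝ → ℕ} {h : ℝ} (hr : Tendsto (fun A => (r A : ℝ) / A) atTop (𝓝 h)) :
    Tendsto (fun A => ((r A - 1 : ℕ) : ℝ) / A) atTop (𝓝 h) := by
  have h1 : Tendsto (fun A : ℝ => (r A : ℝ) / A - 1 / A) atTop (𝓝 h) := by
    simpa using hr.sub (tendsto_const_div_atTop_zero 1)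
  refine tendsto_of_tendsto_of_tendsto_of_le_of_le' h1 hr ?_ ?_
  · filter_upwards [eventually_gt_atTop 0] with A hA
    rw [← sub_div]
    gcongr
    rw [sub_le_iff_le_add]
    exact_mod_cast (by omega : r A ≤ r A - 1 + 1)
  · filter_upwards [eventually_gt_atTop 0] with A hA
    gcongr
    omega

lemma tendsto_add_one_div {r : ℝ → ℕ} {h : ℝ} (hr : Tendsto (fun A => (r A : ℝ) / A) atTop (𝓝 h)) :
    Tendsto (fun A => ((r A + 1 : ℕ) : ℝ) / A) atTop (𝓝 h) := by
  simpa [add_div] using hr.add (tendsto_const_div_atTop_zero 1)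

section Convergence

variable {Ω : Type*} [MeasurableSpace Ω] {μ : Measure Ω} [IsProbabilityMeasure μ] {w : ℤ → ℝ}
  {X : ℕ → Ω → ℤ} {j r : ℝ → ℕ} {ξ h : ℝ}

lemma IsSRW.tendsto_not_goodP (hw : GoodWeight w) (hX : IsSRW μ w X) (hξ : 0 ≤ ξ) (hh : 0 < h)
    (hj : Tendsto (fun A => (j A : ℝ) / A) atTop (𝓝 ξ))
    (hr : Tendsto (fun A => (r A : ℝ) / A) atTop (𝓝 h)) {ε : ℝ} (hε : 0 < ε) :
    Tendsto (fun A => μ {ω | ¬ GoodP A (ξ + 2 * h) ε (j A) (r A) fun i => X i ω})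
      atTop (𝓝 0) := by
  obtain ⟨δ, hδ, hδε, hδh⟩ : ∃ δ : ℝ, 0 < δ ∧ δ < ε ∧ δ < 2 * h :=
    ⟨min ε h / 2, by positivity, by linarith [min_le_left ε h], by linarith [min_le_right ε h]⟩
  have hr' := tendsto_sub_one_div hr
  have hj' := tendsto_add_one_div hj
  have hn (a : ℝ) (ha : 0 ≤ a) := tendsto_toNat_floor_div ha
  have h00 : Tendsto (fun A : ℝ => ((0 : ℕ) : ℝ) / A) atTop (𝓝 0) := by simp
  have t1 := tendsto_chainLaw_zero_of_gt (J := fun _ => 0) hw le_rfl hr' h00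
    (hn (2 * h + δ) (by linarith)) hh (by linarith)
  have t2 := tendsto_chainLaw_zero_of_lt (J := fun _ => 0) hw le_rfl
    (by linarith : 0 ≤ 2 * h - δ) hr' h00 (hn (2 * h - δ) (by linarith)) hh (by linarith)
  have t3 := tendsto_chainLaw_zero_of_gt hw hξ hr' hj'
    (hn (2 * h + ξ + δ) (by linarith)) hh (by linarith)
  have t4 := tendsto_chainLaw_zero_of_lt hw hξ (by linarith : 0 ≤ 2 * h + ξ - δ) hr' hj'
    (hn (2 * h + ξ - δ) (by linarith)) hh (by linarith)
  have hsum := (((ENNReal.tendsto_ofReal t1).add t2).add (ENNReal.tendsto_ofReal t3)).add t4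
  simp only [ENNReal.ofReal_zero, add_zero, zero_add] at hsum
  refine tendsto_of_tendsto_of_tendsto_of_le_of_le' tendsto_const_nhds hsum
    (Eventually.of_forall fun _ => zero_le) ?_
  have hr1 : ∀ᶠ A in atTop, 0 < (r A : ℝ) / A := hr.eventually (lt_mem_nhds hh)
  have e1 := (hj.add (hn (2 * h - δ) (by linarith))).eventually
    (lt_mem_nhds (show ξ + 2 * h - ε < ξ + (2 * h - δ) by linarith))
  have e2 := (hj.add (hn (2 * h + δ) (by linarith))).eventually
    (gt_mem_nhds (show ξ + (2 * h + δ) < ξ + 2 * h + ε by linarith))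
  have e3 := (hn (2 * h + ξ - δ) (by linarith)).eventually
    (lt_mem_nhds (show ξ + 2 * h - ε < 2 * h + ξ - δ by linarith))
  have e4 := (hn (2 * h + ξ + δ) (by linarith)).eventually
    (gt_mem_nhds (show 2 * h + ξ + δ < ξ + 2 * h + ε by linarith))
  filter_upwards [hr1, e1, e2, e3, e4, eventually_gt_atTop 0] with A hr1 e1 e2 e3 e4 hA
  have hr2 : 1 ≤ r A := by
    rcases Nat.eq_zero_or_pos (r A) with h0 | h0
    · simp [h0] at hr1
    · exact h0
  have hA' := inv_pos.2 hA
  simp only [div_eq_inv_mul, ← mul_add] at e1 e2 e3 e4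
  exact hX.measure_not_goodP_le hw.1 hr2 hA e1.le e2.le (by linarith) e4.le

lemma IsSRW.tendsto_not_goodM (hw : GoodWeight w) (hX : IsSRW μ w X) (hξ : 0 ≤ ξ) (hh : 0 < h)
    (hj : Tendsto (fun A => (j A : ℝ) / A) atTop (𝓝 ξ)) (hj1 : ∀ᶠ A in atTop, 1 ≤ j A)
    (hr : Tendsto (fun A => (r A : ℝ) / A) atTop (𝓝 h)) {ε : ℝ} (hε : 0 < ε) :
    Tendsto (fun A => μ {ω | ¬ GoodM A (ξ + 2 * h) ε (j A) (r A) fun i => X i ω})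
      atTop (𝓝 0) := by
  have t1 := hX.tendsto_not_goodP hw hξ hh (tendsto_sub_one_div hj) hr hε
  have t2 := hX.tendsto_not_goodP hw hξ hh (tendsto_sub_one_div hj) (tendsto_add_one_div hr) hε
  have hsum := t1.add t2
  rw [add_zero] at hsum
  refine tendsto_of_tendsto_of_tendsto_of_le_of_le' tendsto_const_nhds hsum
    (Eventually.of_forall fun _ => zero_le) ?_
  filter_upwards [hj1, eventually_gt_atTop 0] with A hj1 hA
  refine le_trans ?_ (add_zero _).le
  rw [← hX.ae_step hw.1]
  refine le_trans (measure_mono fun ω hω => ?_) ((measure_union_le _ _).trans (add_le_add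
    (measure_union_le _ _) le_rfl))
  by_contra hnot
  simp only [Set.mem_union, Set.mem_ofPred_eq, not_or, not_not] at hnot
  obtain ⟨⟨h1, h2⟩, h3, h4⟩ := hnot
  have := goodM_of_goodP h3 h4 hA h1 h2
  rw [show ((j A - 1 : ℕ) : ℤ) + 1 = j A by omega] at this
  exact hω this

lemma IsSRW.tendsto_not_goodM_neg (hw : GoodWeight w) (hX : IsSRW μ w X) (hξ : 0 ≤ ξ) (hh : 0 < h)
    (hj : Tendsto (fun A => (j A : ℝ) / A) atTop (𝓝 ξ))
    (hr : Tendsto (fun A => (r A : ℝ) / A) atTop (𝓝 h)) {ε : ℝ} (hε : 0 < ε) :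
    Tendsto (fun A => μ {ω | ¬ GoodM A (ξ + 2 * h) ε (-j A) (r A) fun i => X i ω})
      atTop (𝓝 0) := by
  have t := hX.neg.tendsto_not_goodP hw hξ hh hj hr (half_pos hε)
  refine tendsto_of_tendsto_of_tendsto_of_le_of_le' tendsto_const_nhds t
    (Eventually.of_forall fun _ => zero_le) ?_
  filter_upwards [eventually_gt_atTop 0,
    tendsto_inv_atTop_zero.eventually (gt_mem_nhds (half_pos hε))] with A hA hAε
  refine measure_mono fun ω hω hgood => hω ?_
  simpa only [mul_div_cancel₀ ε two_ne_zero] using GoodP.reflect hA hAε.le hgood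

lemma IsSRW.tendsto_not_goodP_neg (hw : GoodWeight w) (hX : IsSRW μ w X) (hξ : 0 ≤ ξ) (hh : 0 < h)
    (hj : Tendsto (fun A => (j A : ℝ) / A) atTop (𝓝 ξ)) (hj1 : ∀ᶠ A in atTop, 1 ≤ j A)
    (hr : Tendsto (fun A => (r A : ℝ) / A) atTop (𝓝 h)) {ε : ℝ} (hε : 0 < ε) :
    Tendsto (fun A => μ {ω | ¬ GoodP A (ξ + 2 * h) ε (-j A) (r A) fun i => X i ω})
      atTop (𝓝 0) := by
  have t := hX.neg.tendsto_not_goodM hw hξ hh hj hj1 hr (half_pos hε)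
  refine tendsto_of_tendsto_of_tendsto_of_le_of_le' tendsto_const_nhds t
    (Eventually.of_forall fun _ => zero_le) ?_
  filter_upwards [eventually_gt_atTop 0,
    tendsto_inv_atTop_zero.eventually (gt_mem_nhds (half_pos hε))] with A hA hAε
  refine measure_mono fun ω hω hgood => hω ?_
  simpa only [mul_div_cancel₀ ε two_ne_zero] using GoodM.reflect hA hAε.le hgood

lemma IsSRW.tendsto_not_good (hw : GoodWeight w) (hX : IsSRW μ w X) (x : ℝ) (hh : 0 < h)
    {ε : ℝ} (hε : 0 < ε) :
    Tendsto (fun A : ℝ => μ {ω | ¬ GoodP A (|x| + 2 * h) ε ⌊A * x⌋ ⌊A * h⌋.toNat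
      fun i => X i ω}) atTop (𝓝 0) ∧
    Tendsto (fun A : ℝ => μ {ω | ¬ GoodM A (|x| + 2 * h) ε ⌊A * x⌋ ⌊A * h⌋.toNat
      fun i => X i ω}) atTop (𝓝 0) := by
  have hr := tendsto_toNat_floor_div hh.le
  rcases lt_trichotomy x 0 with hx | rfl | hx
  · have hcl (A : ℝ) (hA : 0 < A) : (⌊A * x⌋ : ℤ) = -(⌈A * -x⌉₊ : ℤ) := by
      rw [mul_neg, Int.natCast_ceil_eq_ceil (by nlinarith), Int.ceil_neg, neg_neg]
    have hj : Tendsto (fun A : ℝ => (⌈A * -x⌉₊ : ℝ) / A) atTop (𝓝 (-x)) := by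
      refine (tendsto_nat_ceil_mul_div_atTop (neg_nonneg.2 hx.le)).congr fun A => ?_
      rw [mul_comm]
    have hj1 : ∀ᶠ A : ℝ in atTop, 1 ≤ ⌈A * -x⌉₊ := by
      filter_upwards [eventually_gt_atTop 0] with A hA
      exact Nat.ceil_pos.2 (mul_pos hA (neg_pos.2 hx))
    rw [abs_of_neg hx]
    constructor
    · refine (hX.tendsto_not_goodP_neg hw (neg_nonneg.2 hx.le) hh hj hj1 hr hε).congr' ?_
      filter_upwards [eventually_gt_atTop 0] with A hA
      rw [hcl A hA]
    · refine (hX.tendsto_not_goodM_neg hw (neg_nonneg.2 hx.le) hh hj hr hε).congr' ?_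
      filter_upwards [eventually_gt_atTop 0] with A hA
      rw [hcl A hA]
  · have hj : Tendsto (fun A : ℝ => ((0 : ℕ) : ℝ) / A) atTop (𝓝 0) := by simp
    constructor
    · simpa using hX.tendsto_not_goodP (j := fun _ => 0) hw le_rfl hh hj hr hε
    · simpa using hX.tendsto_not_goodM_neg (j := fun _ => 0) hw le_rfl hh hj hr hε
  · have hcl (A : ℝ) (hA : 0 < A) : ⌊A * x⌋ = (⌊A * x⌋.toNat : ℤ) :=
      (Int.toNat_of_nonneg (Int.floor_nonneg.2 (by positivity))).symm
    have hj := tendsto_toNat_floor_div hx.le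
    have hj1 : ∀ᶠ A : ℝ in atTop, 1 ≤ ⌊A * x⌋.toNat := by
      filter_upwards [eventually_ge_atTop x⁻¹] with A hA
      have h1 : 1 ≤ A * x := by
        rw [← inv_mul_cancel₀ hx.ne']
        exact mul_le_mul_of_nonneg_right hA hx.le
      have := Int.le_floor.2 (show ((1 : ℤ) : ℝ) ≤ A * x by simpa using h1)
      omega
    rw [abs_of_pos hx]
    constructor
    · refine (hX.tendsto_not_goodP hw hx.le hh hj hr hε).congr' ?_
      filter_upwards [eventually_gt_atTop 0] with A hA
      rw [← hcl A hA]
    · refine (hX.tendsto_not_goodM hw hx.le hh hj hj1 hr hε).congr' ?_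
      filter_upwards [eventually_gt_atTop 0] with A hA
      rw [← hcl A hA]

end Convergence

/-- as `A → ∞`, `A⁻¹ λ±_{⌊Ax⌋,⌊Ah⌋} → -|x| - 2h` and
`A⁻¹ ρ±_{⌊Ax⌋,⌊Ah⌋} → |x| + 2h` in probability. -/
theorem stmt_14 (w : ℤ → ℝ) (hw : GoodWeight w)
    {Ω : Type*} [MeasurableSpace Ω] (μ : Measure Ω) [IsProbabilityMeasure μ]
    (X : ℕ → Ω → ℤ) (hX : IsSRW μ w X) (x h : ℝ) (hh : 0 < h) :
    ∀ ε > (0 : ℝ),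
      Tendsto (fun A : ℝ => μ {ω |
          ε < |A⁻¹ * (lamEdgeP (fun i => X i ω) ⌊A * x⌋ (⌊A * h⌋).toNat : ℝ) -
            (-|x| - 2 * h)|}) atTop (𝓝 0) ∧
      Tendsto (fun A : ℝ => μ {ω |
          ε < |A⁻¹ * (lamEdgeM (fun i => X i ω) ⌊A * x⌋ (⌊A * h⌋).toNat : ℝ) -
            (-|x| - 2 * h)|}) atTop (𝓝 0) ∧
      Tendsto (fun A : ℝ => μ {ω |
          ε < |A⁻¹ * (rhoEdgeP (fun i => X i ω) ⌊A * x⌋ (⌊A * h⌋).toNat : ℝ) -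
            (|x| + 2 * h)|}) atTop (𝓝 0) ∧
      Tendsto (fun A : ℝ => μ {ω |
          ε < |A⁻¹ * (rhoEdgeM (fun i => X i ω) ⌊A * x⌋ (⌊A * h⌋).toNat : ℝ) -
            (|x| + 2 * h)|}) atTop (𝓝 0) := by
  intro ε hε
  obtain ⟨hP, hM⟩ := hX.tendsto_not_good hw x hh hε
  rw [← neg_add']
  have hle {f g : ℝ → ℝ≥0∞} (hg : Tendsto g atTop (𝓝 0)) (hfg : ∀ A, f A ≤ g A) :
      Tendsto f atTop (𝓝 0) :=
    tendsto_of_tendsto_of_tendsto_of_le_of_le tendsto_const_nhds hg (fun _ => zero_le) hfg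
  refine ⟨hle hP fun A => measure_mono fun ω hω hgood => ?_,
    hle hM fun A => measure_mono fun ω hω hgood => ?_,
    hle hP fun A => measure_mono fun ω hω hgood => ?_,
    hle hM fun A => measure_mono fun ω hω hgood => ?_⟩ <;>
  obtain ⟨-, l, ρ, hl, hρ, h1, h2⟩ := hgood
  · rw [Set.mem_ofPred_eq, lamEdgeP, hl.csInf_eq] at hω
    exact not_lt.2 h1 hω
  · rw [Set.mem_ofPred_eq, lamEdgeM, hl.csInf_eq] at hω
    exact not_lt.2 h1 hω
  · rw [Set.mem_ofPred_eq, rhoEdgeP, hρ.csSup_eq] at hω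
    exact not_lt.2 h2 hω
  · rw [Set.mem_ofPred_eq, rhoEdgeM, hρ.csSup_eq] at hω
    exact not_lt.2 h2 hω
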